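/- Let (J,𝓑,η) be a (k,p)-loose Markov space and G=(U,W,E) a bigraph with deg(w)≤k for all w∈W and deg(u)≤p for all u∈U. Then the homomorphism measure η^G is a finite measure and is partition approximable: for every exhausting partition sequence (𝒫_i), η_{𝒫_i}^G(C) → η^G(C) as i→∞ for every box C=∏_{v∈U∪W}B_v with B_v∈𝓑. -/

import Mathlib

open MeasureTheory ProbabilityTheory Finset Filter
open scoped ENNReal

variable {J : Type*} [MeasurableSpace J]

/-- The joint law `σ_k` of `k` independent single steps of the kernel `P`, started from a
common `π`-random point; here the steps are indexed by an arbitrary finite type `ι`. -/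
noncomputable def stepMeasureIdx (π : Measure J) (P : Kernel J J) (ι : Type*) [Fintype ι] :
    Measure (ι → J) :=
  π.bind fun x => Measure.pi fun _ : ι => P x

/-- The density `s_ι = dσ_ι/dπ^ι`. -/
noncomputable def stepDensityIdx (π : Measure J) (P : Kernel J J) (ι : Type*) [Fintype ι] :
    (ι → J) → ℝ≥0∞ :=
  (stepMeasureIdx π P ι).rnDeriv (Measure.pi fun _ : ι => π)

/-- `k`-looseness: `σ_k ≪ π^k`. -/
def KLoose (π : Measure J) (P : Kernel J J) (k : ℕ) : Prop :=
  stepMeasureIdx π P (Fin k) ≪ Measure.pi fun _ : Fin k => π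

/-- `(k,p)`-looseness: `k`-loose and `s_k ∈ L^p(π^k)`. -/
def KPLoose (π : Measure J) (P : Kernel J J) (k p : ℕ) : Prop :=
  KLoose π P k ∧
    ∫⁻ x, stepDensityIdx π P (Fin k) x ^ p ∂(Measure.pi fun _ : Fin k => π) < ⊤

section Bigraph

variable {U W' : Type*} [Fintype U] [Fintype W'] [DecidableEq U] [DecidableEq W']

/-- Neighbourhood in `U` of a right vertex `w` of a bigraph with edge set `E ⊆ U × W`. -/
def nbrW (E : Finset (U × W')) (w : W') : Finset U :=
  Finset.univ.filter fun u => (u, w) ∈ E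

/-- Neighbourhood in `W` of a left vertex `u` of a bigraph with edge set `E ⊆ U × W`. -/
def nbrU (E : Finset (U × W')) (u : U) : Finset W' :=
  Finset.univ.filter fun w => (u, w) ∈ E

/-- `ψ` is a *star disintegration family* for `(π, P)` over the finite index type `ι`:
a measurable family `(ψ_x : x ∈ J^ι)` of finite measures on `J` with
`∫_A ψ_x(B) dπ^ι(x) = ∫_B P_y^{⊗ι}(A) dπ(y)` for all measurable `A ⊆ J^ι`, `B ⊆ J`.
Informally, `ψ_x` is the measure on common neighbours of the points `x i`. -/
def IsStarDisint (π : Measure J) (P : Kernel J J) {ι : Type*} [Fintype ι]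
    (ψ : Kernel (ι → J) J) : Prop :=
  (∀ x, IsFiniteMeasure (ψ x)) ∧
  ∀ (A : Set (ι → J)) (B : Set J), MeasurableSet A → MeasurableSet B →
    ∫⁻ x in A, ψ x B ∂(Measure.pi fun _ : ι => π)
      = ∫⁻ y in B, (Measure.pi fun _ : ι => P y) A ∂π

/-- The homomorphism measure `η^G` on `J^U × J^W` of a bigraph `G = (U, W, E)`, built from a
star disintegration family `ψ`: the points of `U` are i.i.d. `π`-points `x`, and the points
`w ∈ W` are then independent with "distributions" `ψ_w (x|_{N(w)})`.  On boxes,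
`η^G(∏ A_u × ∏ B_w) = ∫_{∏ A_u} ∏_w ψ_{x|N(w)}(B_w) dπ^U(x)`. -/
noncomputable def homMeasure (π : Measure J) (E : Finset (U × W'))
    (ψ : ∀ w : W', Kernel (↥(nbrW E w) → J) J) : Measure ((U → J) × (W' → J)) :=
  (Measure.pi fun _ : U => π).bind fun x =>
    (Measure.dirac x).prod (Measure.pi fun w : W' => ψ w fun u => x u.1)

/-- The `1`-regular step graphon of the Markov space `η` associated with the finite partition
encoded by the classifying map `c : J → Fin mm`: its value at `(a, b)` is
`η(P(a) × P(b)) / (π(P(a)) π(P(b)))` where `P(z)` is the partition class of `z`. -/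
noncomputable def stepW (η : Measure (J × J)) {mm : ℕ} (c : J → Fin mm) (a b : J) : ℝ≥0∞ :=
  η ((c ⁻¹' {c a}) ×ˢ (c ⁻¹' {c b})) /
    ((η.map Prod.fst) (c ⁻¹' {c a}) * (η.map Prod.fst) (c ⁻¹' {c b}))

/-- The value of the homomorphism measure `η_𝒫^G = (W_𝒫)^G ⬝ π^V` of the bigraph
`G = (U, W, E)` in the step graphon of the partition `c`, on the box `∏ A_u × ∏ B_w`. -/
noncomputable def stepBoxVal (η : Measure (J × J)) {mm : ℕ} (c : J → Fin mm)
    (E : Finset (U × W')) (A : U → Set J) (B : W' → Set J) : ℝ≥0∞ :=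
  ∫⁻ x : U → J in Set.univ.pi A,
    ∫⁻ y : W' → J in Set.univ.pi B,
      ∏ e ∈ E, stepW η c (x e.1) (y e.2)
    ∂(Measure.pi fun _ : W' => η.map Prod.fst) ∂(Measure.pi fun _ : U => η.map Prod.fst)

end Bigraph

section Inequalities

lemma real_tangent_of_le (n : ℕ) {b t : ℝ} (hb : 0 ≤ b) (ht : 0 ≤ t) :
    (n + 2) * b ^ (n + 1) * t + b ^ (n + 2) + t ^ (n + 2) ≤ (b + t) ^ (n + 2) := by
  induction n with
  | zero => norm_num; nlinarith
  | succ n ih =>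
    have h1 : 0 ≤ b ^ (n + 1) := by positivity
    have h2 : 0 ≤ t ^ (n + 2) := by positivity
    have h3 := mul_le_mul_of_nonneg_left ih (add_nonneg hb ht)
    have h4 : 0 ≤ (n + 2 : ℝ) * (b ^ (n + 1) * t ^ 2) := by positivity
    have h5 : 0 ≤ b * t ^ (n + 2) := by positivity
    push_cast
    have e1 : (b + t) ^ (n + 1 + 2) = (b + t) * (b + t) ^ (n + 2) := by ring
    rw [e1]
    refine le_trans ?_ h3
    have : (b + t) * ((n + 2) * b ^ (n + 1) * t + b ^ (n + 2) + t ^ (n + 2)) -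
        ((n + 1 + 2 : ℝ) * b ^ (n + 1 + 1) * t + b ^ (n + 1 + 2) + t ^ (n + 1 + 2)) =
        (n + 2 : ℝ) * (b ^ (n + 1) * t ^ 2) + b * t ^ (n + 2) := by ring
    linarith

lemma real_tangent_of_ge (n : ℕ) {a r : ℝ} (ha : 0 ≤ a) (hr : 0 ≤ r) :
    (n + 2) * (a + r) ^ (n + 1) * a + r ^ (n + 2) ≤ a ^ (n + 2) + (n + 1) * (a + r) ^ (n + 2) := by
  induction n with
  | zero => norm_num; nlinarith
  | succ n ih =>
    have h3 := mul_le_mul_of_nonneg_left ih ha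
    have h4 : r ^ (n + 1) ≤ (a + r) ^ (n + 1) := by gcongr; linarith
    have h5 : r ^ (n + 1) * r ^ 2 ≤ (a + r) ^ (n + 1) * ((n + 2) * r ^ 2) := by
      refine mul_le_mul h4 ?_ (by positivity) (by positivity)
      have : 0 ≤ (n : ℝ) * r ^ 2 := by positivity
      nlinarith [sq_nonneg r]
    have h6 : 0 ≤ a * r ^ (n + 2) := by positivity
    push_cast
    have : (a ^ (n + 1 + 2) + (n + 1 + 1 : ℝ) * (a + r) ^ (n + 1 + 2)) -
        (n + 1 + 2 : ℝ) * (a + r) ^ (n + 1 + 1) * a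
        - (a * (a ^ (n + 2) + (n + 1) * (a + r) ^ (n + 2)) - a * ((n + 2) * (a + r) ^ (n + 1) * a))
        = (a + r) ^ (n + 1) * ((n + 2) * r ^ 2) := by ring
    have e : r ^ (n + 1 + 2) = r ^ (n + 1) * r ^ 2 := by ring
    rw [e]
    nlinarith

lemma ENNReal.uniform_convexity_pow (n : ℕ) (a b : ℝ≥0∞) :
    (n + 2) * b ^ (n + 1) * a + ((a - b) + (b - a)) ^ (n + 2) ≤
      a ^ (n + 2) + (n + 1) * b ^ (n + 2) := by
  induction a with
  | top => simp
  | coe a =>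
  induction b with
  | top => simp [ENNReal.mul_top]
  | coe b =>
  norm_cast
  rcases le_total b a with h | h
  · obtain ⟨t, rfl⟩ := exists_add_of_le h
    have := real_tangent_of_le n b.2 t.2
    rw [tsub_eq_zero_of_le h, add_tsub_cancel_left, add_zero, ← NNReal.coe_le_coe]
    push_cast
    simp only [NNReal.val_eq_coe] at this
    have e : (n + 2 : ℝ) * b ^ (n + 1) * (b + t) = (n + 2 : ℝ) * b ^ (n + 1) * t +
      (n + 2) * b ^ (n + 2) := by ring
    rw [e]
    linarith
  · obtain ⟨t, rfl⟩ := exists_add_of_le h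
    have := real_tangent_of_ge n a.2 t.2
    rw [tsub_eq_zero_of_le h, add_tsub_cancel_left, zero_add, ← NNReal.coe_le_coe]
    push_cast
    simpa only [NNReal.val_eq_coe] using this

lemma ENNReal.young_pow (n : ℕ) (a b : ℝ≥0∞) :
    (n + 1) * b ^ n * a ≤ a ^ (n + 1) + n * b ^ (n + 1) := by
  cases n with
  | zero => simp
  | succ n =>
    have := (le_self_add).trans (ENNReal.uniform_convexity_pow n a b)
    push_cast
    rw [add_assoc (n : ℝ≥0∞), one_add_one_eq_two]
    exact this

lemma ENNReal.prod_le_prod_add_sum {ι : Type*} (s : Finset ι) (a b d : ι → ℝ≥0∞)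
    (ha : ∀ i, a i ≤ 1) (hb : ∀ i, b i ≤ 1) (h : ∀ i, a i ≤ b i + d i) :
    ∏ i ∈ s, a i ≤ ∏ i ∈ s, b i + ∑ i ∈ s, d i := by
  classical
  induction s using Finset.induction_on with
  | empty => simp
  | insert i s hi ih =>
    rw [Finset.prod_insert hi, Finset.prod_insert hi, Finset.sum_insert hi]
    calc a i * ∏ j ∈ s, a j ≤ (b i + d i) * ∏ j ∈ s, a j := by gcongr; exact h i
      _ = b i * ∏ j ∈ s, a j + d i * ∏ j ∈ s, a j := add_mul _ _ _
      _ ≤ b i * (∏ j ∈ s, b j + ∑ j ∈ s, d j) + d i * 1 := by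
          gcongr
          exact Finset.prod_le_one' fun j _ => ha j
      _ ≤ b i * ∏ j ∈ s, b j + 1 * ∑ j ∈ s, d j + d i * 1 := by
          rw [mul_add]; gcongr; exact hb i
      _ = _ := by ring

lemma ENNReal.tendsto_of_le_add {α : Type*} {l : Filter α} {u e : α → ℝ≥0∞} {a : ℝ≥0∞}
    (ha : a ≠ ⊤) (h1 : ∀ i, u i ≤ a + e i) (h2 : ∀ i, a ≤ u i + e i)
    (he : Tendsto e l (nhds 0)) : Tendsto u l (nhds a) := by
  rw [ENNReal.tendsto_nhds ha]
  intro ε hε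
  filter_upwards [(ENNReal.tendsto_nhds_zero.1 he) ε hε] with i hi
  exact ⟨tsub_le_iff_right.2 ((h2 i).trans (by gcongr)), (h1 i).trans (by gcongr)⟩

lemma ENNReal.add_pow_le_two_pow (n : ℕ) (a b : ℝ≥0∞) :
    (a + b) ^ n ≤ 2 ^ n * (a ^ n + b ^ n) := by
  calc (a + b) ^ n ≤ (2 * max a b) ^ n := by
        gcongr
        rw [two_mul]
        exact add_le_add (le_max_left _ _) (le_max_right _ _)
    _ = 2 ^ n * (max a b) ^ n := mul_pow _ _ _
    _ ≤ 2 ^ n * (a ^ n + b ^ n) := by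
        gcongr
        rcases le_total a b with h | h
        · rw [max_eq_right h]; exact le_add_self
        · rw [max_eq_left h]; exact le_self_add

end Inequalities

section Finner

variable {U W' : Type*} [DecidableEq U]

lemma lmarginal_update_of_indep (π : Measure J) [IsProbabilityMeasure π] {g : (U → J) → ℝ≥0∞}
    {u : U} (hg : ∀ x y, g (Function.update x u y) = g x) (S : Finset U) (x : U → J) (y : J) :
    (lmarginal (fun _ : U => π) S g) (Function.update x u y) =
      (lmarginal (fun _ : U => π) S g) x := by
  by_cases hu : u ∈ S
  · exact lmarginal_update_of_mem _ hu g x y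
  · unfold lmarginal
    refine lintegral_congr fun z => ?_
    rw [← hg (Function.updateFinset x S z) y]
    congr 1
    ext v
    by_cases hv : v = u
    · subst hv; simp [Function.updateFinset, hu]
    · simp [Function.updateFinset, Function.update_of_ne hv]

variable [Fintype U]

/-- Finner's generalised Hölder inequality on a product of probability spaces. -/
lemma lintegral_prod_le_of_degree_le (π : Measure J) [IsProbabilityMeasure π]
    (T : Finset W') (p : ℕ) (hp : 1 ≤ p) (N : W' → Finset U) (g : W' → (U → J) → ℝ≥0∞)
    (hg : ∀ w, Measurable (g w))
    (hN : ∀ w u, u ∉ N w → ∀ x y, g w (Function.update x u y) = g w x)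
    (hdeg : ∀ u, (T.filter fun w => u ∈ N w).card ≤ p) :
    ∫⁻ x, ∏ w ∈ T, g w x ∂(Measure.pi fun _ : U => π) ≤
      ∏ w ∈ T, (∫⁻ x, g w x ^ p ∂(Measure.pi fun _ : U => π)) ^ (1 / p : ℝ) := by
  have hp0 : (0 : ℝ) < p := by exact_mod_cast hp
  have hpow : ∀ y : ℝ≥0∞, (y ^ p) ^ (1 / p : ℝ) = y := fun y => by
    rw [← ENNReal.rpow_natCast, ← ENNReal.rpow_mul, mul_one_div_cancel hp0.ne', ENNReal.rpow_one]
  have key : ∀ S : Finset U, ∀ x : U → J,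
      (lmarginal (fun _ : U => π) S fun x => ∏ w ∈ T, g w x) x ≤
        ∏ w ∈ T, ((lmarginal (fun _ : U => π) S fun x => g w x ^ p) x) ^ (1 / p : ℝ) := by
    intro S
    induction S using Finset.induction_on with
    | empty => intro x; simp only [lmarginal_empty, hpow]; rfl
    | insert u S hu ih =>
      intro x
      have hm : ∀ w, Measurable (lmarginal (fun _ : U => π) S fun x => g w x ^ p) := fun w =>
        Measurable.lmarginal _ ((hg w).pow_const p)
      rw [lmarginal_insert _ (by fun_prop) hu]
      refine (lintegral_mono fun y => ih _).trans ?_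
      have hmu : ∀ w, Measurable fun y =>
          (lmarginal (fun _ : U => π) S fun x => g w x ^ p) (Function.update x u y) := fun w =>
        (hm w).comp (measurable_update x)
      have hins : ∀ w, (lmarginal (fun _ : U => π) (insert u S) fun x => g w x ^ p) x =
          ∫⁻ y, (lmarginal (fun _ : U => π) S fun x => g w x ^ p) (Function.update x u y) ∂π :=
        fun w => lmarginal_insert _ ((hg w).pow_const p) hu x
      simp only [hins]
      rw [← Finset.prod_filter_mul_prod_filter_not T (fun w => u ∈ N w)]
      have hconst : ∀ w ∈ T.filter (fun w => u ∉ N w), ∀ y,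
          (lmarginal (fun _ : U => π) S fun x => g w x ^ p) (Function.update x u y) =
          (lmarginal (fun _ : U => π) S fun x => g w x ^ p) x := by
        intro w hw y
        refine lmarginal_update_of_indep π (fun x y => ?_) S x y
        simp only [hN w u (Finset.mem_filter.1 hw).2]
      have e1 : ∀ y, ∏ w ∈ T, ((lmarginal (fun _ : U => π) S fun x => g w x ^ p)
            (Function.update x u y)) ^ (1 / p : ℝ) =
          (∏ w ∈ T.filter (fun w => u ∈ N w), ((lmarginal (fun _ : U => π) S
            fun x => g w x ^ p) (Function.update x u y)) ^ (1 / p : ℝ)) *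
          ∏ w ∈ T.filter (fun w => u ∉ N w), ((lmarginal (fun _ : U => π) S
            fun x => g w x ^ p) x) ^ (1 / p : ℝ) := by
        intro y
        rw [← Finset.prod_filter_mul_prod_filter_not T (fun w => u ∈ N w)]
        congr 1
        exact Finset.prod_congr rfl fun w hw => by rw [hconst w hw]
      simp only [e1]
      rw [lintegral_mul_const _ (Finset.measurable_prod _ fun w _ => (hmu w).pow_const _)]
      refine mul_le_mul' ?_ (le_of_eq (Finset.prod_congr rfl fun w hw => ?_))
      · have h := ENNReal.lintegral_mul_prod_norm_pow_le (μ := π)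
          (T.filter (fun w => u ∈ N w)) (g := fun _ => 1)
          (f := fun w y => (lmarginal (fun _ : U => π) S fun x => g w x ^ p)
            (Function.update x u y)) aemeasurable_const (fun w _ => (hmu w).aemeasurable)
          (1 - (T.filter (fun w => u ∈ N w)).card / p) (p := fun _ => (1 / p : ℝ))
          (by simp; ring) (by
            rw [sub_nonneg, div_le_one hp0]
            exact_mod_cast hdeg u) (fun _ _ => by positivity)
        simpa using h
      · simp only [hconst w hw, lintegral_const, measure_univ, mul_one]
  obtain ⟨x⟩ : Nonempty (U → J) := by
    have := π.nonempty_of_neZero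
    infer_instance
  have := key Finset.univ x
  simpa only [lmarginal_univ] using this

/-- `L^p` convergence of the factors implies convergence of the integral of the product when each
coordinate is used by at most `p` factors. -/
lemma tendsto_lintegral_prod_of_degree_le [Fintype W'] [DecidableEq W']
    (π : Measure J) [IsProbabilityMeasure π]
    (p : ℕ) (hp : 1 ≤ p) (N : W' → Finset U) (f : ℕ → W' → (U → J) → ℝ≥0∞)
    (s : W' → (U → J) → ℝ≥0∞) (D : ℕ → W' → (U → J) → ℝ≥0∞)
    (hf : ∀ i w, Measurable (f i w)) (hs : ∀ w, Measurable (s w)) (hD : ∀ i w, Measurable (D i w))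
    (hfN : ∀ i w u, u ∉ N w → ∀ x y, f i w (Function.update x u y) = f i w x)
    (hsN : ∀ w u, u ∉ N w → ∀ x y, s w (Function.update x u y) = s w x)
    (hDN : ∀ i w u, u ∉ N w → ∀ x y, D i w (Function.update x u y) = D i w x)
    (hdeg : ∀ u, (Finset.univ.filter fun w => u ∈ N w).card ≤ p)
    (hfs : ∀ i w x, f i w x ≤ s w x + D i w x) (hsf : ∀ i w x, s w x ≤ f i w x + D i w x)
    (hsp : ∀ w, ∫⁻ x, s w x ^ p ∂(Measure.pi fun _ : U => π) < ⊤)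
    (hDp : ∀ w, Tendsto (fun i => ∫⁻ x, D i w x ^ p ∂(Measure.pi fun _ : U => π)) atTop (nhds 0))
    (A : Set (U → J)) :
    Tendsto (fun i => ∫⁻ x in A, ∏ w, f i w x ∂(Measure.pi fun _ : U => π)) atTop
      (nhds (∫⁻ x in A, ∏ w, s w x ∂(Measure.pi fun _ : U => π))) := by
  set ν := Measure.pi fun _ : U => π with hν
  have hp0 : (0 : ℝ) < p := by exact_mod_cast hp
  have hmix : ∀ (R : Finset W') (a b : W' → (U → J) → ℝ≥0∞),
      (∀ w, Measurable (a w)) → (∀ w, Measurable (b w)) →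
      (∀ w u, u ∉ N w → ∀ x y, a w (Function.update x u y) = a w x) →
      (∀ w u, u ∉ N w → ∀ x y, b w (Function.update x u y) = b w x) →
      ∫⁻ x, (∏ w ∈ R, a w x) * ∏ w ∈ Finset.univ \ R, b w x ∂ν ≤
        (∏ w ∈ R, (∫⁻ x, a w x ^ p ∂ν) ^ (1 / p : ℝ)) *
          ∏ w ∈ Finset.univ \ R, (∫⁻ x, b w x ^ p ∂ν) ^ (1 / p : ℝ) := by
    intro R a b ha hb haN hbN
    have := lintegral_prod_le_of_degree_le π Finset.univ p hp N
      (fun w x => if w ∈ R then a w x else b w x)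
      (fun w => by by_cases h : w ∈ R <;> simp [h, ha, hb])
      (fun w u hu x y => by
        by_cases h : w ∈ R
        · simpa [h] using haN w u hu x y
        · simpa [h] using hbN w u hu x y) hdeg
    have e : ∀ F G : W' → ℝ≥0∞, ∏ w, (if w ∈ R then F w else G w) =
        (∏ w ∈ R, F w) * ∏ w ∈ Finset.univ \ R, G w := by
      intro F G
      rw [← Finset.prod_sdiff (Finset.subset_univ R), mul_comm]
      congr 1
      · exact Finset.prod_congr rfl fun w hw => if_pos hw
      · exact Finset.prod_congr rfl fun w hw => if_neg (Finset.mem_sdiff.1 hw).2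
    simp only [e] at this
    refine this.trans (le_of_eq ?_)
    rw [← e]
    refine Finset.prod_congr rfl fun w _ => ?_
    by_cases h : w ∈ R <;> simp [h, hν]
  have hexp : ∀ (a b d : W' → (U → J) → ℝ≥0∞), (∀ w, Measurable (b w)) →
      (∀ w, Measurable (d w)) →
      (∀ w u, u ∉ N w → ∀ x y, b w (Function.update x u y) = b w x) →
      (∀ w u, u ∉ N w → ∀ x y, d w (Function.update x u y) = d w x) →
      (∀ w x, a w x ≤ b w x + d w x) →
      ∫⁻ x in A, ∏ w, a w x ∂ν ≤ ∫⁻ x in A, ∏ w, b w x ∂ν +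
        ∑ R ∈ Finset.univ.powerset.erase Finset.univ,
          (∏ w ∈ R, (∫⁻ x, b w x ^ p ∂ν) ^ (1 / p : ℝ)) *
            ∏ w ∈ Finset.univ \ R, (∫⁻ x, d w x ^ p ∂ν) ^ (1 / p : ℝ) := by
    intro a b d hb hd hbN hdN h
    calc ∫⁻ x in A, ∏ w, a w x ∂ν ≤ ∫⁻ x in A, ∏ w, (b w x + d w x) ∂ν :=
          lintegral_mono fun x => Finset.prod_le_prod' fun w _ => h w x
      _ = ∫⁻ x in A, ∑ R ∈ Finset.univ.powerset,
            (∏ w ∈ R, b w x) * ∏ w ∈ Finset.univ \ R, d w x ∂ν := by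
          simp only [Finset.prod_add]
      _ = ∑ R ∈ Finset.univ.powerset,
            ∫⁻ x in A, (∏ w ∈ R, b w x) * ∏ w ∈ Finset.univ \ R, d w x ∂ν :=
          lintegral_finsetSum _ fun R _ => by fun_prop
      _ = ∫⁻ x in A, ∏ w, b w x ∂ν + ∑ R ∈ Finset.univ.powerset.erase Finset.univ,
            ∫⁻ x in A, (∏ w ∈ R, b w x) * ∏ w ∈ Finset.univ \ R, d w x ∂ν := by
          rw [← Finset.add_sum_erase _ _ (Finset.mem_powerset_self Finset.univ)]
          simp
      _ ≤ _ := by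
          gcongr with R hR
          exact (setLIntegral_le_lintegral _ _).trans (hmix R b d hb hd hbN hdN)
  have hs1 : ∀ w, (∫⁻ x, s w x ^ p ∂ν) ^ (1 / p : ℝ) ≠ ⊤ := fun w =>
    ENNReal.rpow_ne_top_of_nonneg (by positivity) (hsp w).ne
  have hD1 : ∀ w, Tendsto (fun i => (∫⁻ x, D i w x ^ p ∂ν) ^ (1 / p : ℝ)) atTop (nhds 0) := by
    intro w
    have := (ENNReal.continuous_rpow_const (y := (1 / p : ℝ))).tendsto 0 |>.comp (hDp w)
    rwa [ENNReal.zero_rpow_of_pos (by positivity)] at this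
  have hf_le : ∀ i w, (∫⁻ x, f i w x ^ p ∂ν) ^ (1 / p : ℝ) ≤
      (∫⁻ x, s w x ^ p ∂ν) ^ (1 / p : ℝ) + (∫⁻ x, D i w x ^ p ∂ν) ^ (1 / p : ℝ) := by
    intro i w
    have h := ENNReal.lintegral_Lp_add_le (μ := ν) (p := p) (hs w).aemeasurable
      (hD i w).aemeasurable (by exact_mod_cast hp)
    simp only [Pi.add_apply, ENNReal.rpow_natCast] at h
    refine le_trans ?_ h
    gcongr with x
    exact hfs i w x
  have hlim : ∀ F : ℕ → W' → ℝ≥0∞, (∀ i w, F i w ≤ (∫⁻ x, s w x ^ p ∂ν) ^ (1 / p : ℝ) +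
        (∫⁻ x, D i w x ^ p ∂ν) ^ (1 / p : ℝ)) →
      Tendsto (fun i => ∑ R ∈ Finset.univ.powerset.erase Finset.univ, (∏ w ∈ R, F i w) *
        ∏ w ∈ Finset.univ \ R, (∫⁻ x, D i w x ^ p ∂ν) ^ (1 / p : ℝ)) atTop (nhds 0) := by
    intro F hF
    rw [← Finset.sum_const_zero (s := Finset.univ.powerset.erase (Finset.univ : Finset W'))]
    refine tendsto_finsetSum _ fun R hR => ?_
    obtain ⟨w₀, hw₀⟩ : (Finset.univ \ R).Nonempty := by
      rw [Finset.sdiff_nonempty]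
      intro h
      exact (Finset.mem_erase.1 hR).1 (Finset.univ_subset_iff.1 h)
    have h1 : Tendsto (fun i => ∏ w ∈ R, ((∫⁻ x, s w x ^ p ∂ν) ^ (1 / p : ℝ) +
        (∫⁻ x, D i w x ^ p ∂ν) ^ (1 / p : ℝ))) atTop
        (nhds (∏ w ∈ R, ((∫⁻ x, s w x ^ p ∂ν) ^ (1 / p : ℝ) + 0))) := by
      refine ENNReal.tendsto_finsetProd_of_ne_top _ (fun w _ => ?_) (fun w _ => ?_)
      · exact tendsto_const_nhds.add (hD1 w)
      · simpa using hs1 w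
    have h2 : Tendsto (fun i => ∏ w ∈ Finset.univ \ R,
        (∫⁻ x, D i w x ^ p ∂ν) ^ (1 / p : ℝ)) atTop (nhds 0) := by
      rw [← Finset.prod_eq_zero (f := fun _ : W' => (0 : ℝ≥0∞)) hw₀ rfl]
      exact ENNReal.tendsto_finsetProd_of_ne_top _ (fun w _ => hD1 w) (fun w _ => by simp)
    have h3 := ENNReal.Tendsto.mul h1 (Or.inr ENNReal.zero_ne_top) h2
      (Or.inr (ENNReal.prod_ne_top fun w _ => by simpa using hs1 w))
    rw [mul_zero] at h3
    refine tendsto_of_tendsto_of_tendsto_of_le_of_le tendsto_const_nhds h3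
      (fun i => zero_le) (fun i => ?_)
    dsimp only
    gcongr with w hw
    exact hF i w
  have hfin : ∫⁻ x in A, ∏ w, s w x ∂ν ≠ ⊤ := by
    refine ((setLIntegral_le_lintegral _ _).trans
      (lintegral_prod_le_of_degree_le π Finset.univ p hp N s hs hsN hdeg)).trans_lt ?_ |>.ne
    exact (ENNReal.prod_ne_top fun w _ => hs1 w).lt_top
  refine ENNReal.tendsto_of_le_add hfin (e := fun i =>
    (∑ R ∈ Finset.univ.powerset.erase Finset.univ,
      (∏ w ∈ R, (∫⁻ x, s w x ^ p ∂ν) ^ (1 / p : ℝ)) *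
        ∏ w ∈ Finset.univ \ R, (∫⁻ x, D i w x ^ p ∂ν) ^ (1 / p : ℝ)) +
    ∑ R ∈ Finset.univ.powerset.erase Finset.univ,
      (∏ w ∈ R, (∫⁻ x, f i w x ^ p ∂ν) ^ (1 / p : ℝ)) *
        ∏ w ∈ Finset.univ \ R, (∫⁻ x, D i w x ^ p ∂ν) ^ (1 / p : ℝ)) ?_ ?_ ?_
  · intro i
    refine (hexp (f i) s (D i) hs (hD i) hsN (hDN i) (hfs i)).trans ?_
    gcongr
    exact le_self_add
  · intro i
    refine (hexp s (f i) (D i) (hf i) (hD i) (hfN i) (hDN i) (hsf i)).trans ?_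
    gcongr
    exact le_add_self
  · have := (hlim (fun _ w => (∫⁻ x, s w x ^ p ∂ν) ^ (1 / p : ℝ))
      (fun i w => le_self_add)).add (hlim (fun i w => (∫⁻ x, f i w x ^ p ∂ν) ^ (1 / p : ℝ)) hf_le)
    rwa [add_zero] at this

end Finner

section StarDensity

/-- The value of the step graphon of `η` on the pair of classes `a`, `b` of the partition `c`. -/
noncomputable def cellDensity (η : Measure (J × J)) (π : Measure J) {m : ℕ} (c : J → Fin m)
    (a b : Fin m) : ℝ≥0∞ :=
  η ((c ⁻¹' {a}) ×ˢ (c ⁻¹' {b})) / (π (c ⁻¹' {a}) * π (c ⁻¹' {b}))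

/-- The density of the star homomorphism measure of the step graphon of the partition `c`, with
the centre restricted to `B`. -/
noncomputable def starDensity (η : Measure (J × J)) (π : Measure J) {m : ℕ} (c : J → Fin m)
    (ι : Type*) [Fintype ι] (B : Set J) (x : ι → J) : ℝ≥0∞ :=
  ∑ j, π (B ∩ c ⁻¹' {j}) * ∏ u, cellDensity η π c (c (x u)) j

/-- A reversible kernel `P` with stationary measure `π` and edge measure `η`. -/
structure IsReversibleDisint (η : Measure (J × J)) (π : Measure J) (P : Kernel J J) : Prop where
  prod_eq : ∀ A B : Set J, MeasurableSet A → MeasurableSet B → η (A ×ˢ B) = ∫⁻ x in A, P x B ∂π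
  symm : ∀ A B : Set J, MeasurableSet A → MeasurableSet B → η (A ×ˢ B) = η (B ×ˢ A)

lemma lintegral_pi_prod {ι : Type*} [Fintype ι] (μ : Measure J) [IsProbabilityMeasure μ]
    (h : ι → J → ℝ≥0∞) (hh : ∀ u, Measurable (h u)) :
    ∫⁻ x, ∏ u, h u (x u) ∂(Measure.pi fun _ : ι => μ) = ∏ u, ∫⁻ x, h u x ∂μ := by
  have hind := iIndepFun_pi (μ := fun _ : ι => μ) (X := h) fun u => (hh u).aemeasurable
  rw [lintegral_prod_eq_prod_lintegral_of_indepFun Finset.univ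
    (fun u (x : ι → J) => h u (x u)) hind fun u => (hh u).comp (measurable_pi_apply u)]
  refine Finset.prod_congr rfl fun u _ => ?_
  exact (measurePreserving_eval (fun _ : ι => μ) u).lintegral_comp (hh u)

lemma setLIntegral_pi_prod {ι : Type*} [Fintype ι] (μ : Measure J) [IsProbabilityMeasure μ]
    (A : ι → Set J) (hA : ∀ u, MeasurableSet (A u)) (h : ι → J → ℝ≥0∞)
    (hh : ∀ u, Measurable (h u)) :
    ∫⁻ x in Set.univ.pi A, ∏ u, h u (x u) ∂(Measure.pi fun _ : ι => μ) =
      ∏ u, ∫⁻ x in A u, h u x ∂μ := by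
  classical
  rw [← lintegral_indicator (MeasurableSet.univ_pi hA)]
  have : ∀ x : ι → J, (Set.univ.pi A).indicator (fun x : ι → J => ∏ u, h u (x u)) x =
      ∏ u, (A u).indicator (h u) (x u) := by
    intro x
    by_cases hx : x ∈ Set.univ.pi A
    · rw [Set.indicator_of_mem hx]
      exact Finset.prod_congr rfl fun u _ => (Set.indicator_of_mem (hx u (Set.mem_univ u)) _).symm
    · rw [Set.indicator_of_notMem hx]
      simp only [Set.mem_pi, Set.mem_univ, true_implies, not_forall] at hx
      obtain ⟨u, hu⟩ := hx
      exact (Finset.prod_eq_zero (Finset.mem_univ u) (Set.indicator_of_notMem hu _)).symm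
  simp only [this]
  rw [lintegral_pi_prod μ _ fun u => (hh u).indicator (hA u)]
  exact Finset.prod_congr rfl fun u _ => lintegral_indicator (hA u) _

lemma setLIntegral_eq_sum_cells (μ : Measure J) {m : ℕ} {c : J → Fin m} (hc : Measurable c)
    {B : Set J} (hB : MeasurableSet B) (F : J → ℝ≥0∞) :
    ∫⁻ x in B, F x ∂μ = ∑ j, ∫⁻ x in B ∩ c ⁻¹' {j}, F x ∂μ := by
  have hU : B = ⋃ j, B ∩ c ⁻¹' {j} := by ext; simp
  conv_lhs => rw [hU]
  rw [lintegral_iUnion, tsum_fintype]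
  · exact fun j => hB.inter (hc (measurableSet_singleton j))
  · intro i j hij
    refine Disjoint.inter_left' _ (Disjoint.inter_right' _ ?_)
    exact Disjoint.preimage _ (by simpa using hij)

lemma setLIntegral_comp_cells (μ : Measure J) {m : ℕ} {c : J → Fin m} (hc : Measurable c)
    {B : Set J} (hB : MeasurableSet B) (g : Fin m → ℝ≥0∞) :
    ∫⁻ x in B, g (c x) ∂μ = ∑ j, g j * μ (B ∩ c ⁻¹' {j}) := by
  rw [setLIntegral_eq_sum_cells μ hc hB]
  refine Finset.sum_congr rfl fun j _ => ?_
  rw [← setLIntegral_const]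
  refine setLIntegral_congr_fun (hB.inter (hc (measurableSet_singleton j))) fun x hx => ?_
  simp only [show c x = j from hx.2]

lemma lintegral_comp_cells (μ : Measure J) {m : ℕ} {c : J → Fin m} (hc : Measurable c)
    (g : Fin m → ℝ≥0∞) : ∫⁻ x, g (c x) ∂μ = ∑ j, g j * μ (c ⁻¹' {j}) := by
  simpa using setLIntegral_comp_cells μ hc MeasurableSet.univ g

lemma measurable_of_cells {m : ℕ} {c : J → Fin m} (hc : Measurable c) (g : Fin m → ℝ≥0∞) :
    Measurable fun x => g (c x) :=
  (measurable_of_countable g).comp hc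

variable {η : Measure (J × J)} {π : Measure J} {P : Kernel J J} {m : ℕ} {c : J → Fin m}

lemma cellDensity_mul [IsFiniteMeasure π] (hπ : ∀ j, π (c ⁻¹' {j}) ≠ 0) (a b : Fin m) :
    π (c ⁻¹' {a}) * π (c ⁻¹' {b}) * cellDensity η π c a b =
      η ((c ⁻¹' {a}) ×ˢ (c ⁻¹' {b})) :=
  ENNReal.mul_div_cancel (mul_ne_zero (hπ a) (hπ b))
    (ENNReal.mul_ne_top (measure_ne_top _ _) (measure_ne_top _ _))

lemma cellDensity_ne_top [IsFiniteMeasure η] (hπ : ∀ j, π (c ⁻¹' {j}) ≠ 0) (a b : Fin m) :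
    cellDensity η π c a b ≠ ⊤ :=
  ENNReal.div_ne_top (measure_ne_top _ _) (mul_ne_zero (hπ a) (hπ b))

lemma measurable_starDensity (hc : Measurable c) (ι : Type*) [Fintype ι] (B : Set J) :
    Measurable (starDensity η π c ι B) := by
  unfold starDensity
  refine Finset.measurable_sum _ fun j _ => (Finset.measurable_prod _ fun u _ => ?_).const_mul _
  exact (measurable_of_cells hc fun a => cellDensity η π c a j).comp (measurable_pi_apply u)

lemma lintegral_starDensity_pow_lt_top [IsFiniteMeasure η] [IsProbabilityMeasure π]
    (hπ : ∀ j, π (c ⁻¹' {j}) ≠ 0) (ι : Type*) [Fintype ι] (B : Set J) (n : ℕ) :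
    ∫⁻ x, starDensity η π c ι B x ^ n ∂(Measure.pi fun _ : ι => π) < ⊤ := by
  classical
  have hfin : ∑ κ : ι → Fin m,
      (∑ j, π (B ∩ c ⁻¹' {j}) * ∏ u, cellDensity η π c (κ u) j) ^ n < ⊤ := by
    refine ENNReal.sum_lt_top.2 fun κ _ => ENNReal.pow_lt_top (ENNReal.sum_lt_top.2 fun j _ => ?_)
    exact ENNReal.mul_lt_top (measure_lt_top _ _)
      (ENNReal.prod_lt_top fun u _ => (cellDensity_ne_top hπ _ _).lt_top)
  refine (lintegral_mono (g := fun _ => ∑ κ : ι → Fin m,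
    (∑ j, π (B ∩ c ⁻¹' {j}) * ∏ u, cellDensity η π c (κ u) j) ^ n) fun x => ?_).trans_lt ?_
  · exact Finset.single_le_sum (f := fun κ : ι → Fin m =>
      (∑ j, π (B ∩ c ⁻¹' {j}) * ∏ u, cellDensity η π c (κ u) j) ^ n) (fun _ _ => zero_le)
      (Finset.mem_univ fun u => c (x u))
  · simpa using hfin

lemma lintegral_prod_cellDensity_eq_starDensity (hc : Measurable c) {ι : Type*} [Fintype ι]
    {B : Set J} (hB : MeasurableSet B) (x : ι → J) :
    ∫⁻ y in B, ∏ u, cellDensity η π c (c (x u)) (c y) ∂π = starDensity η π c ι B x := by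
  rw [setLIntegral_comp_cells π hc hB fun j => ∏ u, cellDensity η π c (c (x u)) j]
  exact Finset.sum_congr rfl fun j _ => mul_comm _ _

/-- The measure of `A` under the average of the kernel over the class `j`. -/
noncomputable def cellStep (η : Measure (J × J)) (π : Measure J) {m : ℕ} (c : J → Fin m)
    (A : Set J) (j : Fin m) : ℝ≥0∞ :=
  ∫⁻ x in A, cellDensity η π c (c x) j ∂π

lemma setLIntegral_pi_starDensity [IsProbabilityMeasure π] (hc : Measurable c)
    {ι : Type*} [Fintype ι] {B : Set J} (hB : MeasurableSet B) (A : ι → Set J)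
    (hA : ∀ u, MeasurableSet (A u)) :
    ∫⁻ x in Set.univ.pi A, starDensity η π c ι B x ∂(Measure.pi fun _ : ι => π) =
      ∫⁻ y in B, ∏ u, cellStep η π c (A u) (c y) ∂π := by
  unfold starDensity
  rw [lintegral_finsetSum _ fun j _ => ?_,
    setLIntegral_comp_cells π hc hB fun j => ∏ u, cellStep η π c (A u) j]
  · refine Finset.sum_congr rfl fun j _ => ?_
    rw [lintegral_const_mul _ ?_, setLIntegral_pi_prod π A hA
      (fun _ z => cellDensity η π c (c z) j)
      fun u => measurable_of_cells hc fun a => cellDensity η π c a j, mul_comm]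
    · rfl
    · exact Finset.measurable_prod _ fun u _ =>
        (measurable_of_cells hc fun a => cellDensity η π c a j).comp (measurable_pi_apply u)
  · exact (Finset.measurable_prod _ fun u _ =>
        (measurable_of_cells hc fun a => cellDensity η π c a j).comp
          (measurable_pi_apply u)).const_mul _

lemma measurable_measure_pi (κ : Kernel J J) [IsMarkovKernel κ] (ι : Type*) [Fintype ι] :
    Measurable fun y => Measure.pi fun _ : ι => κ y := by
  refine Measurable.measure_of_isPiSystem (generateFrom_pi (α := fun _ : ι => J)).symm
    isPiSystem_pi ?_ ?_
  · rintro _ ⟨A, hA, rfl⟩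
    simp only [Measure.pi_pi]
    exact Finset.measurable_prod _ fun u _ => Kernel.measurable_coe κ (hA u (Set.mem_univ u))
  · simp

lemma IsStarDisint.lintegral_mul [IsProbabilityMeasure π] [IsMarkovKernel P] {ι : Type*}
    [Fintype ι] {ψ : Kernel (ι → J) J} (hψ : IsStarDisint π P ψ) {B : Set J}
    (hB : MeasurableSet B) {φ : (ι → J) → ℝ≥0∞} (hφ : Measurable φ) :
    ∫⁻ x, ψ x B * φ x ∂(Measure.pi fun _ : ι => π) =
      ∫⁻ y in B, ∫⁻ x, φ x ∂(Measure.pi fun _ : ι => P y) ∂π := by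
  have e : (Measure.pi fun _ : ι => π).withDensity (fun x => ψ x B) =
      (π.restrict B).bind fun y => Measure.pi fun _ : ι => P y := by
    ext A hA
    rw [withDensity_apply _ hA, hψ.2 A B hA hB,
      Measure.bind_apply hA (measurable_measure_pi P ι).aemeasurable]
  have h1 := lintegral_withDensity_eq_lintegral_mul (Measure.pi fun _ : ι => π)
    (Kernel.measurable_coe ψ hB) hφ
  rw [e, Measure.lintegral_bind (measurable_measure_pi P ι).aemeasurable hφ.aemeasurable] at h1
  exact h1.symm

lemma measure_mul_pow_le_setLIntegral_pow {C : Set J} {F : J → ℝ≥0∞} {H : ℝ≥0∞}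
    (hC : π C ≠ ⊤) (hH : H ≠ ⊤) (hF : ∫⁻ x in C, F x ∂π = H * π C) (d : ℕ) :
    H ^ d * π C ≤ ∫⁻ x in C, F x ^ d ∂π := by
  cases d with
  | zero => simp
  | succ n =>
    have h : ∫⁻ x in C, (n + 1) * H ^ n * F x ∂π ≤
        ∫⁻ x in C, (F x ^ (n + 1) + n * H ^ (n + 1)) ∂π :=
      lintegral_mono fun x => ENNReal.young_pow n (F x) H
    rw [lintegral_const_mul' _ _ (by finiteness), hF, lintegral_add_right _ measurable_const,
      setLIntegral_const] at h
    have hfin : (n : ℝ≥0∞) * H ^ (n + 1) * π C ≠ ⊤ := by finiteness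
    refine (ENNReal.add_le_add_iff_right hfin).1 (le_trans (le_of_eq ?_) h)
    ring

lemma IsReversibleDisint.setLIntegral_comp_cells (h : IsReversibleDisint η π P)
    (hc : Measurable c) (g : Fin m → ℝ≥0∞) {C : Set J} (hC : MeasurableSet C) :
    ∫⁻ y in C, ∫⁻ x, g (c x) ∂(P y) ∂π = ∑ a, g a * η (C ×ˢ (c ⁻¹' {a})) := by
  simp only [lintegral_comp_cells _ hc]
  rw [lintegral_finsetSum _ fun a _ =>
    (Kernel.measurable_coe P (hc (measurableSet_singleton a))).const_mul _]
  refine Finset.sum_congr rfl fun a _ => ?_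
  rw [lintegral_const_mul _ (Kernel.measurable_coe P (hc (measurableSet_singleton a))),
    h.prod_eq _ _ hC (hc (measurableSet_singleton a))]

/-- The density of the common-neighbour measure with the centre weighted by the average of `B`
over the classes of `c`. -/
noncomputable def avgStar (π : Measure J) {m : ℕ} (c : J → Fin m) {ι : Type*}
    (ψ : Kernel (ι → J) J) (B : Set J) (x : ι → J) : ℝ≥0∞ :=
  ∑ j, π (B ∩ c ⁻¹' {j}) / π (c ⁻¹' {j}) * ψ x (c ⁻¹' {j})

lemma measurable_avgStar (hc : Measurable c) {ι : Type*} (ψ : Kernel (ι → J) J) (B : Set J) :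
    Measurable (avgStar π c ψ B) :=
  Finset.measurable_sum _ fun j _ =>
    (Kernel.measurable_coe ψ (hc (measurableSet_singleton j))).const_mul _

lemma lintegral_starDensity_mul_prod_le [IsFiniteMeasure η] [IsProbabilityMeasure π]
    [IsMarkovKernel P] (h : IsReversibleDisint η π P) (hc : Measurable c)
    (hπ : ∀ j, π (c ⁻¹' {j}) ≠ 0) {ι : Type*} [Fintype ι] {ψ : Kernel (ι → J) J}
    (hψ : IsStarDisint π P ψ) (B : Set J) (g : Fin m → ℝ≥0∞) (hg : ∀ a, g a ≠ ⊤) :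
    ∫⁻ x, starDensity η π c ι B x * ∏ u, g (c (x u)) ∂(Measure.pi fun _ : ι => π) ≤
      ∫⁻ x, avgStar π c ψ B x * ∏ u, g (c (x u)) ∂(Measure.pi fun _ : ι => π) := by
  have hcell : ∀ j, MeasurableSet (c ⁻¹' {j}) := fun j => hc (measurableSet_singleton j)
  have hgm : Measurable fun x : ι → J => ∏ u, g (c (x u)) :=
    Finset.measurable_prod _ fun u _ => (measurable_of_cells hc g).comp (measurable_pi_apply u)
  set H : Fin m → ℝ≥0∞ := fun j => ∫⁻ z, cellDensity η π c (c z) j * g (c z) ∂π with hHdef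
  have hH : ∀ j, H j = ∑ a, cellDensity η π c a j * g a * π (c ⁻¹' {a}) := fun j =>
    lintegral_comp_cells π hc fun a => cellDensity η π c a j * g a
  have hHtop : ∀ j, H j ≠ ⊤ := fun j => by
    rw [hH]
    exact ENNReal.sum_ne_top.2 fun a _ => ENNReal.mul_ne_top
      (ENNReal.mul_ne_top (cellDensity_ne_top hπ _ _) (hg a)) (measure_ne_top _ _)
  have hL : ∫⁻ x, starDensity η π c ι B x * ∏ u, g (c (x u)) ∂(Measure.pi fun _ : ι => π) =
      ∑ j, π (B ∩ c ⁻¹' {j}) * H j ^ Fintype.card ι := by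
    have e : ∀ x : ι → J, starDensity η π c ι B x * ∏ u, g (c (x u)) =
        ∑ j, π (B ∩ c ⁻¹' {j}) * ∏ u, (cellDensity η π c (c (x u)) j * g (c (x u))) := by
      intro x
      rw [starDensity, Finset.sum_mul]
      refine Finset.sum_congr rfl fun j _ => ?_
      rw [mul_assoc, ← Finset.prod_mul_distrib]
    have hm : ∀ j, Measurable fun z => cellDensity η π c (c z) j * g (c z) := fun j =>
      measurable_of_cells hc fun a => cellDensity η π c a j * g a
    have hm' : ∀ j, Measurable fun x : ι → J =>
        ∏ u, (cellDensity η π c (c (x u)) j * g (c (x u))) := fun j =>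
      Finset.measurable_prod _ fun u _ => (hm j).comp (measurable_pi_apply u)
    simp only [e]
    rw [lintegral_finsetSum _ fun j _ => (hm' j).const_mul _]
    refine Finset.sum_congr rfl fun j _ => ?_
    rw [lintegral_const_mul _ (hm' j),
      lintegral_pi_prod π (fun _ z => cellDensity η π c (c z) j * g (c z)) fun _ => hm j]
    simp [hHdef]
  have hR : ∫⁻ x, avgStar π c ψ B x * ∏ u, g (c (x u)) ∂(Measure.pi fun _ : ι => π) =
      ∑ j, π (B ∩ c ⁻¹' {j}) / π (c ⁻¹' {j}) *
        ∫⁻ y in c ⁻¹' {j}, (∫⁻ x, g (c x) ∂(P y)) ^ Fintype.card ι ∂π := by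
    have e : ∀ x : ι → J, avgStar π c ψ B x * ∏ u, g (c (x u)) =
        ∑ j, π (B ∩ c ⁻¹' {j}) / π (c ⁻¹' {j}) * (ψ x (c ⁻¹' {j}) * ∏ u, g (c (x u))) := by
      intro x
      rw [avgStar, Finset.sum_mul]
      exact Finset.sum_congr rfl fun j _ => mul_assoc _ _ _
    have hm' : ∀ j, Measurable fun x : ι → J => ψ x (c ⁻¹' {j}) * ∏ u, g (c (x u)) := fun j =>
      (Kernel.measurable_coe ψ (hcell j)).mul hgm
    simp only [e]
    rw [lintegral_finsetSum _ fun j _ => (hm' j).const_mul _]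
    refine Finset.sum_congr rfl fun j _ => ?_
    rw [lintegral_const_mul _ (hm' j), hψ.lintegral_mul (hcell j) hgm]
    congr 1
    refine lintegral_congr fun y => ?_
    rw [lintegral_pi_prod (P y) (fun _ z => g (c z)) fun _ => measurable_of_cells hc g]
    simp
  rw [hL, hR]
  refine Finset.sum_le_sum fun j _ => ?_
  have hj : ∫⁻ y in c ⁻¹' {j}, ∫⁻ x, g (c x) ∂(P y) ∂π = H j * π (c ⁻¹' {j}) := by
    rw [h.setLIntegral_comp_cells hc g (hcell j), hH, Finset.sum_mul]
    refine Finset.sum_congr rfl fun a _ => ?_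
    rw [h.symm _ _ (hcell j) (hcell a), ← cellDensity_mul hπ a j]
    ring
  have := measure_mul_pow_le_setLIntegral_pow (measure_ne_top _ _) (hHtop j) hj (Fintype.card ι)
  calc π (B ∩ c ⁻¹' {j}) * H j ^ Fintype.card ι
      = π (B ∩ c ⁻¹' {j}) / π (c ⁻¹' {j}) * (H j ^ Fintype.card ι * π (c ⁻¹' {j})) := by
        rw [mul_comm (H j ^ _), ← mul_assoc, ENNReal.div_mul_cancel (hπ j) (measure_ne_top _ _)]
    _ ≤ _ := by gcongr

lemma lintegral_starDensity_pow_succ_le [IsFiniteMeasure η] [IsProbabilityMeasure π]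
    [IsMarkovKernel P] (h : IsReversibleDisint η π P) (hc : Measurable c)
    (hπ : ∀ j, π (c ⁻¹' {j}) ≠ 0) {ι : Type*} [Fintype ι] {ψ : Kernel (ι → J) J}
    (hψ : IsStarDisint π P ψ) (B : Set J) (n : ℕ) :
    ∫⁻ x, starDensity η π c ι B x ^ (n + 1) ∂(Measure.pi fun _ : ι => π) ≤
      ∫⁻ x, starDensity η π c ι B x ^ n * avgStar π c ψ B x ∂(Measure.pi fun _ : ι => π) := by
  have e : ∀ x : ι → J, starDensity η π c ι B x ^ n = ∑ z : Fin n → Fin m,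
      (∏ l, π (B ∩ c ⁻¹' {z l})) * ∏ u, ∏ l, cellDensity η π c (c (x u)) (z l) := by
    intro x
    rw [starDensity, Fintype.sum_pow]
    refine Finset.sum_congr rfl fun z _ => ?_
    rw [Finset.prod_mul_distrib, Finset.prod_comm]
  have hm : ∀ z : Fin n → Fin m, Measurable fun x : ι → J =>
      ∏ u, ∏ l, cellDensity η π c (c (x u)) (z l) := fun z =>
    Finset.measurable_prod _ fun u _ =>
      (measurable_of_cells hc fun a => ∏ l, cellDensity η π c a (z l)).comp (measurable_pi_apply u)
  have e' : ∀ F : (ι → J) → ℝ≥0∞, Measurable F →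
      ∫⁻ x, starDensity η π c ι B x ^ n * F x ∂(Measure.pi fun _ : ι => π) =
      ∑ z : Fin n → Fin m, (∏ l, π (B ∩ c ⁻¹' {z l})) *
        ∫⁻ x, F x * ∏ u, ∏ l, cellDensity η π c (c (x u)) (z l)
          ∂(Measure.pi fun _ : ι => π) := by
    intro F hF
    simp only [e, Finset.sum_mul]
    rw [lintegral_finsetSum]
    swap
    · exact fun z _ => ((hm z).const_mul _).mul hF
    refine Finset.sum_congr rfl fun z _ => ?_
    rw [← lintegral_const_mul]
    swap
    · exact hF.mul (hm z)
    refine lintegral_congr fun x => ?_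
    ring
  simp only [pow_succ]
  rw [e' _ (measurable_starDensity hc ι B), e' _ (measurable_avgStar hc ψ B)]
  refine Finset.sum_le_sum fun z _ => ?_
  refine mul_le_mul' le_rfl ?_
  exact lintegral_starDensity_mul_prod_le h hc hπ hψ B (fun a => ∏ l, cellDensity η π c a (z l))
    fun a => ENNReal.prod_ne_top fun l _ => cellDensity_ne_top hπ _ _

/-- The distance between `starDensity` and `avgStar` is controlled by the drop of the `L^p` norm. -/
lemma lintegral_dist_starDensity_pow_add_le [IsFiniteMeasure η] [IsProbabilityMeasure π]
    [IsMarkovKernel P] (h : IsReversibleDisint η π P) (hc : Measurable c)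
    (hπ : ∀ j, π (c ⁻¹' {j}) ≠ 0) {ι : Type*} [Fintype ι] {ψ : Kernel (ι → J) J}
    (hψ : IsStarDisint π P ψ) (B : Set J) (n : ℕ) :
    ∫⁻ x, ((avgStar π c ψ B x - starDensity η π c ι B x) +
        (starDensity η π c ι B x - avgStar π c ψ B x)) ^ (n + 2) ∂(Measure.pi fun _ : ι => π) +
      ∫⁻ x, starDensity η π c ι B x ^ (n + 2) ∂(Measure.pi fun _ : ι => π) ≤
      ∫⁻ x, avgStar π c ψ B x ^ (n + 2) ∂(Measure.pi fun _ : ι => π) := by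
  set ν := Measure.pi fun _ : ι => π
  have hf := measurable_starDensity (η := η) (π := π) hc ι B
  have ha := measurable_avgStar (π := π) hc ψ B
  have h1 : ∫⁻ x, ((n + 2) * starDensity η π c ι B x ^ (n + 1) * avgStar π c ψ B x +
      ((avgStar π c ψ B x - starDensity η π c ι B x) +
        (starDensity η π c ι B x - avgStar π c ψ B x)) ^ (n + 2)) ∂ν ≤
      ∫⁻ x, (avgStar π c ψ B x ^ (n + 2) + (n + 1) * starDensity η π c ι B x ^ (n + 2)) ∂ν :=
    lintegral_mono fun x => ENNReal.uniform_convexity_pow n _ _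
  simp only [mul_assoc] at h1
  rw [lintegral_add_left (by fun_prop), lintegral_add_left (by fun_prop),
    lintegral_const_mul _ (by fun_prop), lintegral_const_mul _ (by fun_prop)] at h1
  have h2 := lintegral_starDensity_pow_succ_le h hc hπ hψ B (n + 1)
  have hfin : (n + 1 : ℝ≥0∞) * ∫⁻ x, starDensity η π c ι B x ^ (n + 2) ∂ν ≠ ⊤ :=
    ENNReal.mul_ne_top (by finiteness) (lintegral_starDensity_pow_lt_top hπ ι B (n + 2)).ne
  refine (ENNReal.add_le_add_iff_right hfin).1 (le_trans ?_ h1)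
  calc _ = (n + 2) * ∫⁻ x, starDensity η π c ι B x ^ (n + 2) ∂ν + ∫⁻ x,
        ((avgStar π c ψ B x - starDensity η π c ι B x) +
        (starDensity η π c ι B x - avgStar π c ψ B x)) ^ (n + 2) ∂ν := by ring
    _ ≤ _ := by gcongr

end StarDensity

section Exhausting

/-- The average of `F` over the class `j` of the partition `c`. -/
noncomputable def cellAvg (π : Measure J) {m : ℕ} (c : J → Fin m) (F : J → ℝ≥0∞) (j : Fin m) :
    ℝ≥0∞ :=
  (∫⁻ x in c ⁻¹' {j}, F x ∂π) / π (c ⁻¹' {j})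

/-- The classifying maps `c i` encode an exhausting partition sequence. -/
structure IsExhausting (π : Measure J) {m : ℕ → ℕ} (c : ∀ i, J → Fin (m i)) : Prop where
  measurable : ∀ i, Measurable (c i)
  ne_zero : ∀ i j, π (c i ⁻¹' {j}) ≠ 0
  refines : ∀ i, ∃ g : Fin (m (i + 1)) → Fin (m i), c i = g ∘ c (i + 1)
  exhausts : ∀ A : Set J, MeasurableSet A →
    ∃ B : Set J, MeasurableSet[⨆ i, MeasurableSpace.comap (c i) ⊤] B ∧ π (symmDiff A B) = 0

lemma cellAvg_indicator (π : Measure J) {m : ℕ} {c : J → Fin m} {B : Set J}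
    (hB : MeasurableSet B) (j : Fin m) :
    cellAvg π c (B.indicator 1) j = π (B ∩ c ⁻¹' {j}) / π (c ⁻¹' {j}) := by
  rw [cellAvg, lintegral_indicator_one hB, Measure.restrict_apply hB]

lemma cellAvg_le_one (π : Measure J) {m : ℕ} {c : J → Fin m} {F : J → ℝ≥0∞}
    (hF : ∀ x, F x ≤ 1) (j : Fin m) : cellAvg π c F j ≤ 1 := by
  refine ENNReal.div_le_of_le_mul ?_
  calc _ ≤ ∫⁻ x in c ⁻¹' {j}, 1 ∂π := lintegral_mono fun x => hF x
    _ = _ := by simp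

lemma setLIntegral_cellAvg {π : Measure J} [IsFiniteMeasure π] {m : ℕ} {c : J → Fin m}
    (hc : Measurable c) (hπ : ∀ j, π (c ⁻¹' {j}) ≠ 0) (F : J → ℝ≥0∞) (T : Set (Fin m)) :
    ∫⁻ y in c ⁻¹' T, cellAvg π c F (c y) ∂π = ∫⁻ y in c ⁻¹' T, F y ∂π := by
  have hT : MeasurableSet (c ⁻¹' T) := hc (Set.toFinite T).measurableSet
  rw [setLIntegral_comp_cells π hc hT, setLIntegral_eq_sum_cells π hc hT]
  refine Finset.sum_congr rfl fun j _ => ?_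
  rw [← Set.preimage_inter]
  by_cases hj : j ∈ T
  · rw [Set.inter_eq_right.2 (Set.singleton_subset_iff.2 hj), cellAvg,
      ENNReal.div_mul_cancel (hπ j) (measure_ne_top _ _)]
  · rw [Set.inter_singleton_eq_empty.2 hj]
    simp

lemma lintegral_cellAvg {π : Measure J} [IsFiniteMeasure π] {m : ℕ} {c : J → Fin m}
    (hc : Measurable c) (hπ : ∀ j, π (c ⁻¹' {j}) ≠ 0) (F : J → ℝ≥0∞) :
    ∫⁻ y, cellAvg π c F (c y) ∂π = ∫⁻ y, F y ∂π := by
  simpa using setLIntegral_cellAvg hc hπ F Set.univ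

lemma toReal_cellAvg_ae_eq_condExp {π : Measure J} [IsFiniteMeasure π] {m : ℕ} {c : J → Fin m}
    (hc : Measurable c) (hπ : ∀ j, π (c ⁻¹' {j}) ≠ 0) {F : J → ℝ≥0∞} (hF : Measurable F)
    (hF1 : ∀ x, F x ≤ 1) :
    (fun y => (cellAvg π c F (c y)).toReal) =ᵐ[π]
      π[fun y => (F y).toReal | MeasurableSpace.comap c ⊤] := by
  have hle : MeasurableSpace.comap c ⊤ ≤ (inferInstance : MeasurableSpace J) := by
    rw [← measurable_iff_comap_le]
    exact hc.mono le_rfl (fun s _ => (Set.toFinite s).measurableSet)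
  have hint : ∀ G : J → ℝ≥0∞, Measurable G → (∀ x, G x ≤ 1) →
      Integrable (fun y => (G y).toReal) π := by
    intro G hG hG1
    refine Integrable.of_bound hG.ennreal_toReal.aestronglyMeasurable 1 (.of_forall fun x => ?_)
    rw [Real.norm_of_nonneg ENNReal.toReal_nonneg]
    exact ENNReal.toReal_le_of_le_ofReal zero_le_one (by simpa using hG1 x)
  have hval : ∀ G : J → ℝ≥0∞, Measurable G → (∀ x, G x ≤ 1) → ∀ s,
      ∫ y in s, (G y).toReal ∂π = (∫⁻ y in s, G y ∂π).toReal := by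
    intro G hG hG1 s
    exact integral_toReal hG.aemeasurable
      (.of_forall fun x => (hG1 x).trans_lt ENNReal.one_lt_top)
  have hav := measurable_of_cells hc (cellAvg π c F)
  have hav1 : ∀ x, cellAvg π c F (c x) ≤ 1 := fun x => cellAvg_le_one π hF1 _
  refine ae_eq_condExp_of_forall_setIntegral_eq hle (hint F hF hF1)
    (fun s _ _ => (hint _ hav hav1).integrableOn) ?_ ?_
  · rintro _ ⟨T, _, rfl⟩ -
    rw [hval _ hav hav1, hval F hF hF1, setLIntegral_cellAvg hc hπ]
  · refine StronglyMeasurable.aestronglyMeasurable ?_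
    refine Measurable.stronglyMeasurable ?_
    have h : Measurable[⊤] fun j => (cellAvg π c F j).toReal := measurable_from_top
    exact h.comp (comap_measurable c)

variable {π : Measure J} {m : ℕ → ℕ} {c : ∀ i, J → Fin (m i)}

lemma IsExhausting.comap_mono (h : IsExhausting π c) :
    Monotone fun i => MeasurableSpace.comap (c i) ⊤ := by
  refine monotone_nat_of_le_succ fun i => ?_
  obtain ⟨g, hg⟩ := h.refines i
  rw [hg, ← MeasurableSpace.comap_comp]
  exact MeasurableSpace.comap_mono le_top

lemma IsExhausting.comap_le (h : IsExhausting π c) (i : ℕ) :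
    MeasurableSpace.comap (c i) ⊤ ≤ (inferInstance : MeasurableSpace J) := by
  rw [← measurable_iff_comap_le]
  exact (h.measurable i).mono le_rfl (fun s _ => (Set.toFinite s).measurableSet)

lemma IsExhausting.aestronglyMeasurable (h : IsExhausting π c) {f : J → ℝ}
    (hf : Integrable f π) :
    AEStronglyMeasurable[⨆ i, MeasurableSpace.comap (c i) ⊤] f π := by
  have hle : (⨆ i, MeasurableSpace.comap (c i) ⊤) ≤ (inferInstance : MeasurableSpace J) :=
    iSup_le h.comap_le
  refine Integrable.induction (P := fun f =>
    AEStronglyMeasurable[⨆ i, MeasurableSpace.comap (c i) ⊤] f π) ?_ ?_ ?_ ?_ hf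
  · intro a s hs _
    obtain ⟨t, ht, hst⟩ := h.exhausts s hs
    refine ⟨t.indicator fun _ => a, stronglyMeasurable_const.indicator ht, ?_⟩
    exact indicator_ae_eq_of_ae_eq_set (measure_symmDiff_eq_zero_iff.1 hst)
  · intro f g _ _ _ hf hg
    exact hf.add hg
  · exact isClosed_aestronglyMeasurable hle
  · intro f g hfg _ hf
    exact hf.congr hfg

lemma IsExhausting.tendsto_cellAvg [IsFiniteMeasure π] (h : IsExhausting π c) {F : J → ℝ≥0∞}
    (hF : Measurable F) (hF1 : ∀ x, F x ≤ 1) :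
    ∀ᵐ y ∂π, Tendsto (fun i => cellAvg π (c i) F (c i y)) atTop (nhds (F y)) := by
  set f : J → ℝ := fun y => (F y).toReal
  have hf : Integrable f π := by
    refine Integrable.of_bound hF.ennreal_toReal.aestronglyMeasurable 1 (.of_forall fun x => ?_)
    rw [Real.norm_of_nonneg ENNReal.toReal_nonneg]
    exact ENNReal.toReal_le_of_le_ofReal zero_le_one (by simpa using hF1 x)
  let ℱ : Filtration ℕ (inferInstance : MeasurableSpace J) :=
    ⟨fun i => MeasurableSpace.comap (c i) ⊤, h.comap_mono, h.comap_le⟩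
  have hle : (⨆ i, MeasurableSpace.comap (c i) ⊤) ≤ (inferInstance : MeasurableSpace J) :=
    iSup_le h.comap_le
  have h1 := MeasureTheory.tendsto_ae_condExp (μ := π) (ℱ := ℱ) f
  have h2 : π[f | ⨆ i, ℱ i] =ᵐ[π] f :=
    condExp_of_aestronglyMeasurable' hle (h.aestronglyMeasurable hf) hf
  have h3 : ∀ᵐ y ∂π, ∀ i, (cellAvg π (c i) F (c i y)).toReal = (π[f | ℱ i]) y :=
    ae_all_iff.2 fun i => toReal_cellAvg_ae_eq_condExp (h.measurable i) (h.ne_zero i) hF hF1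
  filter_upwards [h1, h2, h3] with y h1 h2 h3
  rw [h2] at h1
  simp only [← h3] at h1
  refine (ENNReal.tendsto_toReal_iff (fun i => ?_) ?_).1 h1
  · exact ((cellAvg_le_one π hF1 _).trans_lt ENNReal.one_lt_top).ne
  · exact ((hF1 y).trans_lt ENNReal.one_lt_top).ne

end Exhausting

section BoxConvergence

lemma ENNReal.le_add_dist (a b : ℝ≥0∞) : a ≤ b + (a - b + (b - a)) := by
  rw [← add_assoc]
  exact le_add_tsub.trans le_self_add

lemma ENNReal.le_add_dist' (a b : ℝ≥0∞) : b ≤ a + (a - b + (b - a)) := by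
  rw [add_comm (a - b), ← add_assoc]
  exact le_add_tsub.trans le_self_add

lemma ENNReal.tendsto_dist_zero {α : Type*} {l : Filter α} {u : α → ℝ≥0∞} {a : ℝ≥0∞}
    (ha : a ≠ ⊤) (h : Tendsto u l (nhds a)) :
    Tendsto (fun i => u i - a + (a - u i)) l (nhds 0) := by
  have h1 : Tendsto (fun i => u i - a) l (nhds (a - a)) :=
    ENNReal.Tendsto.sub h tendsto_const_nhds (Or.inl ha)
  have h2 : Tendsto (fun i => a - u i) l (nhds (a - a)) :=
    ENNReal.Tendsto.sub tendsto_const_nhds h (Or.inl ha)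
  simpa using h1.add h2

variable {η : Measure (J × J)} {π : Measure J} {P : Kernel J J}

lemma IsReversibleDisint.lintegral_lintegral [IsMarkovKernel P] (h : IsReversibleDisint η π P)
    {F : J → ℝ≥0∞} (hF : Measurable F) : ∫⁻ y, ∫⁻ x, F x ∂(P y) ∂π = ∫⁻ x, F x ∂π := by
  have : π.bind P = π := by
    ext A hA
    rw [Measure.bind_apply hA P.measurable.aemeasurable]
    have h1 := h.prod_eq Set.univ A MeasurableSet.univ hA
    have h2 := h.prod_eq A Set.univ hA MeasurableSet.univ
    rw [h.symm _ _ MeasurableSet.univ hA, h2] at h1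
    simpa using h1.symm
  conv_rhs => rw [← this]
  rw [Measure.lintegral_bind P.measurable.aemeasurable hF.aemeasurable]

section Finite

variable {m : ℕ} {c : J → Fin m}

lemma cellAvg_mono {F G : J → ℝ≥0∞} (h : ∀ x, F x ≤ G x) (j : Fin m) :
    cellAvg π c F j ≤ cellAvg π c G j :=
  ENNReal.div_le_div_right (lintegral_mono h) _

lemma cellAvg_add {F G : J → ℝ≥0∞} (hF : Measurable F) (j : Fin m) :
    cellAvg π c (fun x => F x + G x) j = cellAvg π c F j + cellAvg π c G j := by
  rw [cellAvg, lintegral_add_left hF, ENNReal.add_div]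
  rfl

lemma cellStep_eq_cellAvg [IsFiniteMeasure π] (h : IsReversibleDisint η π P)
    (hc : Measurable c) {A : Set J} (hA : MeasurableSet A) (j : Fin m) :
    cellStep η π c A j =
      cellAvg π c (fun y => ∫⁻ x, cellAvg π c (A.indicator 1) (c x) ∂(P y)) j := by
  have hcell : ∀ j, MeasurableSet (c ⁻¹' {j}) := fun j => hc (measurableSet_singleton j)
  rw [cellStep, setLIntegral_comp_cells π hc hA fun a => cellDensity η π c a j, cellAvg,
    h.setLIntegral_comp_cells hc _ (hcell j), div_eq_mul_inv, Finset.sum_mul]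
  refine Finset.sum_congr rfl fun a _ => ?_
  rw [cellAvg_indicator π hA, h.symm _ _ (hcell j) (hcell a), cellDensity, div_eq_mul_inv,
    div_eq_mul_inv, ENNReal.mul_inv (Or.inr (measure_ne_top _ _)) (Or.inl (measure_ne_top _ _))]
  ring

lemma cellStep_le_one [IsFiniteMeasure π] [IsMarkovKernel P] (h : IsReversibleDisint η π P)
    (hc : Measurable c) {A : Set J} (hA : MeasurableSet A) (j : Fin m) :
    cellStep η π c A j ≤ 1 := by
  rw [cellStep_eq_cellAvg h hc hA]
  refine cellAvg_le_one π (fun y => ?_) j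
  calc _ ≤ ∫⁻ _, 1 ∂(P y) := lintegral_mono fun x =>
        cellAvg_le_one π (fun x => Set.indicator_le_self' (fun _ _ => zero_le) x) _
    _ = 1 := by simp

/-- A bound on the distance between `cellStep` and `P`. -/
noncomputable def cellStepError (π : Measure J) (P : Kernel J J) (c : J → Fin m) (A : Set J)
    (y : J) : ℝ≥0∞ :=
  (cellAvg π c (fun y => P y A) (c y) - P y A + (P y A - cellAvg π c (fun y => P y A) (c y))) +
    cellAvg π c (fun y => ∫⁻ x, (cellAvg π c (A.indicator 1) (c x) - A.indicator 1 x +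
      (A.indicator 1 x - cellAvg π c (A.indicator 1) (c x))) ∂(P y)) (c y)

lemma cellStep_le_add_error [IsFiniteMeasure π] [IsMarkovKernel P]
    (h : IsReversibleDisint η π P) (hc : Measurable c) {A : Set J} (hA : MeasurableSet A) (y : J) :
    cellStep η π c A (c y) ≤ P y A + cellStepError π P c A y := by
  rw [cellStep_eq_cellAvg h hc hA]
  refine (cellAvg_mono (G := fun y => P y A + ∫⁻ x, (cellAvg π c (A.indicator 1) (c x) -
    A.indicator 1 x + (A.indicator 1 x - cellAvg π c (A.indicator 1) (c x))) ∂(P y))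
    (fun z => ?_) _).trans ?_
  · rw [← lintegral_indicator_one hA, ← lintegral_add_left (measurable_one.indicator hA)]
    exact lintegral_mono fun x => ENNReal.le_add_dist _ _
  · rw [cellAvg_add (Kernel.measurable_coe P hA), cellStepError, ← add_assoc]
    gcongr
    exact ENNReal.le_add_dist _ _

lemma le_cellStep_add_error [IsFiniteMeasure π] [IsMarkovKernel P]
    (h : IsReversibleDisint η π P) (hc : Measurable c) {A : Set J} (hA : MeasurableSet A) (y : J) :
    P y A ≤ cellStep η π c A (c y) + cellStepError π P c A y := by
  rw [cellStep_eq_cellAvg h hc hA]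
  have hm := measurable_of_cells hc (cellAvg π c (A.indicator 1))
  have h1 : cellAvg π c (fun y => P y A) (c y) ≤
      cellAvg π c (fun y => ∫⁻ x, cellAvg π c (A.indicator 1) (c x) ∂(P y)) (c y) +
      cellAvg π c (fun y => ∫⁻ x, (cellAvg π c (A.indicator 1) (c x) - A.indicator 1 x +
        (A.indicator 1 x - cellAvg π c (A.indicator 1) (c x))) ∂(P y)) (c y) := by
    rw [← cellAvg_add hm.lintegral_kernel]
    refine cellAvg_mono (fun z => ?_) _
    rw [← lintegral_indicator_one hA, ← lintegral_add_left hm]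
    exact lintegral_mono fun x => ENNReal.le_add_dist' _ _
  calc P y A ≤ _ := ENNReal.le_add_dist' (cellAvg π c (fun y => P y A) (c y)) _
    _ ≤ _ := add_le_add_left h1 _
    _ = _ := by
        rw [cellStepError]
        ring

end Finite

variable {m : ℕ → ℕ} {c : ∀ i, J → Fin (m i)}

lemma IsExhausting.tendsto_lintegral_dist_cellAvg [IsFiniteMeasure π] (h : IsExhausting π c)
    {F : J → ℝ≥0∞} (hF : Measurable F) (hF1 : ∀ x, F x ≤ 1) :
    Tendsto (fun i => ∫⁻ y, (cellAvg π (c i) F (c i y) - F y +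
      (F y - cellAvg π (c i) F (c i y))) ∂π) atTop (nhds 0) := by
  have hm := fun i => measurable_of_cells (h.measurable i) (cellAvg π (c i) F)
  have := tendsto_lintegral_of_dominated_convergence (μ := π)
    (F := fun i y => cellAvg π (c i) F (c i y) - F y + (F y - cellAvg π (c i) F (c i y)))
    (f := fun _ => 0) (fun _ => 2) (fun i => ((hm i).sub hF).add (hF.sub (hm i)))
    (fun i => .of_forall fun y => ?_)
    (by rw [lintegral_const]; finiteness) ?_
  · simpa using this
  · rw [← one_add_one_eq_two]
    exact add_le_add (tsub_le_self.trans (cellAvg_le_one π hF1 _)) (tsub_le_self.trans (hF1 y))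
  · filter_upwards [h.tendsto_cellAvg hF hF1] with y hy
    exact ENNReal.tendsto_dist_zero ((hF1 y).trans_lt ENNReal.one_lt_top).ne hy

lemma IsExhausting.tendsto_lintegral_cellStepError [IsFiniteMeasure π] [IsMarkovKernel P]
    (hex : IsExhausting π c) (h : IsReversibleDisint η π P) {A : Set J} (hA : MeasurableSet A) :
    Tendsto (fun i => ∫⁻ y, cellStepError π P (c i) A y ∂π) atTop (nhds 0) := by
  have hP := Kernel.measurable_coe P hA
  have hI : Measurable (A.indicator (1 : J → ℝ≥0∞)) := measurable_one.indicator hA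
  have h1 := hex.tendsto_lintegral_dist_cellAvg hP fun x => prob_le_one
  have h2 := hex.tendsto_lintegral_dist_cellAvg hI
    fun x => Set.indicator_le_self' (fun _ _ => zero_le) x
  have h3 := h1.add h2
  rw [add_zero] at h3
  refine h3.congr fun i => ?_
  have hm := measurable_of_cells (hex.measurable i) (cellAvg π (c i) (A.indicator 1))
  have hm' := measurable_of_cells (hex.measurable i) (cellAvg π (c i) fun y => P y A)
  unfold cellStepError
  symm
  rw [lintegral_add_left, lintegral_cellAvg (hex.measurable i) (hex.ne_zero i),
    h.lintegral_lintegral]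
  · exact (hm.sub hI).add (hI.sub hm)
  · exact (hm'.sub hP).add (hP.sub hm')

lemma IsExhausting.tendsto_setLIntegral_pi_starDensity [IsProbabilityMeasure π]
    [IsMarkovKernel P] (hex : IsExhausting π c) (h : IsReversibleDisint η π P)
    {ι : Type*} [Fintype ι] {ψ : Kernel (ι → J) J} (hψ : IsStarDisint π P ψ) {B : Set J}
    (hB : MeasurableSet B) (A : ι → Set J) (hA : ∀ u, MeasurableSet (A u)) :
    Tendsto (fun i => ∫⁻ x in Set.univ.pi A, starDensity η π (c i) ι B x
      ∂(Measure.pi fun _ : ι => π)) atTop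
      (nhds (∫⁻ x in Set.univ.pi A, ψ x B ∂(Measure.pi fun _ : ι => π))) := by
  rw [hψ.2 _ B (MeasurableSet.univ_pi hA) hB]
  simp only [setLIntegral_pi_starDensity (hex.measurable _) hB A hA, Measure.pi_pi]
  have hPA : Measurable fun y => ∏ u, P y (A u) :=
    Finset.measurable_prod _ fun u _ => Kernel.measurable_coe P (hA u)
  have hSA : ∀ i, Measurable fun y => ∏ u, cellStep η π (c i) (A u) (c i y) := fun i =>
    Finset.measurable_prod _ fun u _ => measurable_of_cells (hex.measurable i) _
  have hE : ∀ i u, ∫⁻ y in B, cellStepError π P (c i) (A u) y ∂π ≤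
      ∫⁻ y, cellStepError π P (c i) (A u) y ∂π := fun i u => setLIntegral_le_lintegral _ _
  have hEm : ∀ i u, Measurable (cellStepError π P (c i) (A u)) := by
    intro i u
    have hP := Kernel.measurable_coe P (hA u)
    have hm' := measurable_of_cells (hex.measurable i) (cellAvg π (c i) fun y => P y (A u))
    exact ((hm'.sub hP).add (hP.sub hm')).add (measurable_of_cells (hex.measurable i) _)
  refine ENNReal.tendsto_of_le_add (e := fun i => ∑ u, ∫⁻ y, cellStepError π P (c i) (A u) y ∂π)
    ?_ (fun i => ?_) (fun i => ?_) ?_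
  · refine ((lintegral_mono fun y => Finset.prod_le_one' fun u _ => prob_le_one).trans_lt
      (?_ : ∫⁻ _ in B, 1 ∂π < ⊤)).ne
    simp
  · refine (lintegral_mono fun y => ENNReal.prod_le_prod_add_sum Finset.univ _ _ _
      (fun u => cellStep_le_one h (hex.measurable i) (hA u) _) (fun u => prob_le_one)
      (fun u => cellStep_le_add_error h (hex.measurable i) (hA u) y)).trans ?_
    rw [lintegral_add_left hPA, lintegral_finsetSum _ fun u _ => hEm i u]
    exact add_le_add_right (Finset.sum_le_sum fun u _ => hE i u) _
  · refine (lintegral_mono fun y => ENNReal.prod_le_prod_add_sum Finset.univ _ _ _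
      (fun u => prob_le_one) (fun u => cellStep_le_one h (hex.measurable i) (hA u) _)
      (fun u => le_cellStep_add_error h (hex.measurable i) (hA u) y)).trans ?_
    rw [lintegral_add_left (hSA i), lintegral_finsetSum _ fun u _ => hEm i u]
    exact add_le_add_right (Finset.sum_le_sum fun u _ => hE i u) _
  · rw [← Finset.sum_const_zero (s := (Finset.univ : Finset ι))]
    exact tendsto_finsetSum _ fun u _ => hex.tendsto_lintegral_cellStepError h (hA u)

end BoxConvergence

section WeakLimit

variable {X : Type*} [MeasurableSpace X] {ν : Measure X}

lemma setLIntegral_le_of_pow_le [IsFiniteMeasure ν] {f : X → ℝ≥0∞} {n M : ℕ} (hM : M ≠ 0)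
    {K : ℝ≥0∞} (hK : ∫⁻ x, f x ^ (n + 2) ∂ν ≤ K) (R : Set X) :
    ∫⁻ x in R, f x ∂ν ≤ M * ν R + K / M := by
  have hM0 : (M : ℝ≥0∞) ≠ 0 := by exact_mod_cast hM
  have hM1 : (1 : ℝ≥0∞) ≤ M := by exact_mod_cast Nat.one_le_iff_ne_zero.2 hM
  have key : ∀ y : ℝ≥0∞, y ≤ M + y ^ (n + 2) * (M : ℝ≥0∞)⁻¹ := by
    intro y
    rcases le_total y M with h | h
    · exact h.trans le_self_add
    · refine le_trans ?_ le_add_self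
      rw [← div_eq_mul_inv, ENNReal.le_div_iff_mul_le (Or.inl hM0) (Or.inl (by simp))]
      calc y * M ≤ y * y ^ (n + 1) :=
            mul_le_mul' le_rfl (h.trans (le_self_pow (hM1.trans h) (Nat.succ_ne_zero n)))
        _ = y ^ (n + 2) := by ring
  calc ∫⁻ x in R, f x ∂ν ≤ ∫⁻ x in R, (M + f x ^ (n + 2) * (M : ℝ≥0∞)⁻¹) ∂ν :=
        lintegral_mono fun x => key _
    _ = M * ν R + (∫⁻ x in R, f x ^ (n + 2) ∂ν) * (M : ℝ≥0∞)⁻¹ := by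
        rw [lintegral_add_left measurable_const, setLIntegral_const,
          lintegral_mul_const' _ _ (ENNReal.inv_ne_top.2 hM0)]
    _ ≤ M * ν R + K / M := by
        rw [div_eq_mul_inv]
        gcongr
        exact (setLIntegral_le_lintegral _ _).trans hK

lemma tendsto_setLIntegral_of_isPiSystem [IsFiniteMeasure ν] {f : ℕ → X → ℝ≥0∞}
    {s : X → ℝ≥0∞} {n : ℕ} {K : ℝ≥0∞} (hK : K ≠ ⊤) (hs : ∫⁻ x, s x ∂ν ≠ ⊤)
    (hfK : ∀ i, ∫⁻ x, f i x ^ (n + 2) ∂ν ≤ K) {C : Set (Set X)}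
    (hgen : (inferInstance : MeasurableSpace X) = MeasurableSpace.generateFrom C)
    (hpi : IsPiSystem C) (huniv : Set.univ ∈ C)
    (hC : ∀ A ∈ C, Tendsto (fun i => ∫⁻ x in A, f i x ∂ν) atTop (nhds (∫⁻ x in A, s x ∂ν)))
    {A : Set X} (hA : MeasurableSet A) :
    Tendsto (fun i => ∫⁻ x in A, f i x ∂ν) atTop (nhds (∫⁻ x in A, s x ∂ν)) := by
  have hfin : ∀ i A, ∫⁻ x in A, f i x ∂ν ≠ ⊤ := fun i A =>
    ((setLIntegral_le_of_pow_le one_ne_zero (hfK i) A).trans_lt (by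
      simp only [Nat.cast_one, one_mul, div_one]; finiteness)).ne
  have hsfin : ∀ A, ∫⁻ x in A, s x ∂ν ≠ ⊤ := fun A =>
    ((setLIntegral_le_lintegral _ _).trans_lt hs.lt_top).ne
  induction A, hA using MeasurableSpace.induction_on_inter hgen hpi with
  | empty => simp
  | basic A hA => exact hC A hA
  | compl A hA ih =>
    have e : ∀ g : X → ℝ≥0∞, ∫⁻ x in A, g x ∂ν ≠ ⊤ →
        ∫⁻ x in Aᶜ, g x ∂ν = ∫⁻ x in Set.univ, g x ∂ν - ∫⁻ x in A, g x ∂ν := by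
      intro g hg
      rw [Measure.restrict_univ, ← lintegral_add_compl (μ := ν) g hA, ENNReal.add_sub_cancel_left hg]
    rw [e s (hsfin A)]
    simp only [e _ (hfin _ A)]
    exact ENNReal.Tendsto.sub (hC _ huniv) ih (Or.inl (hsfin _))
  | iUnion A hd hA ih =>
    set T : ℕ → Set X := fun N => ⋃ l ∈ Finset.range N, A l with hT
    have hTm : ∀ N, MeasurableSet (T N) := fun N =>
      Finset.measurableSet_biUnion _ fun l _ => hA l
    have hTsub : ∀ N, T N ⊆ ⋃ l, A l := fun N =>
      Set.iUnion₂_subset fun l _ => Set.subset_iUnion A l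
    have hsum : ∀ N (g : X → ℝ≥0∞), ∫⁻ x in T N, g x ∂ν =
        ∑ l ∈ Finset.range N, ∫⁻ x in A l, g x ∂ν := fun N g =>
      lintegral_biUnion_finset (fun a _ b _ hab => hd hab) (fun l _ => hA l) g
    have hTlim : ∀ N, Tendsto (fun i => ∫⁻ x in T N, f i x ∂ν) atTop
        (nhds (∫⁻ x in T N, s x ∂ν)) := by
      intro N
      simp only [hsum]
      exact tendsto_finsetSum _ fun l _ => ih l
    have hsplit : ∀ N (g : X → ℝ≥0∞), ∫⁻ x in ⋃ l, A l, g x ∂ν =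
        ∫⁻ x in T N, g x ∂ν + ∫⁻ x in (⋃ l, A l) \ T N, g x ∂ν := by
      intro N g
      rw [← lintegral_inter_add_sdiff g _ (hTm N), Set.inter_eq_right.2 (hTsub N)]
    have hTmono : Monotone T := fun a b hab =>
      Set.biUnion_subset_biUnion_left (by simpa using Finset.range_mono hab)
    have hTU : ⋃ N, T N = ⋃ l, A l := by
      refine Set.Subset.antisymm (Set.iUnion_subset hTsub) (Set.iUnion_subset fun l => ?_)
      exact Set.Subset.trans (Set.subset_biUnion_of_mem (u := A)
        (show l ∈ Finset.range (l + 1) by simp)) (Set.subset_iUnion T (l + 1))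
    have hR : Tendsto (fun N => ν ((⋃ l, A l) \ T N)) atTop (nhds 0) := by
      have h := tendsto_measure_iInter_atTop (μ := ν) (s := fun N => (⋃ l, A l) \ T N)
        (fun N => ((MeasurableSet.iUnion hA).diff (hTm N)).nullMeasurableSet)
        (fun a b hab => Set.sdiff_subset_sdiff_right (hTmono hab)) ⟨0, measure_ne_top _ _⟩
      rwa [← Set.sdiff_iUnion, hTU, Set.sdiff_self, measure_empty] at h
    refine tendsto_of_le_liminf_of_limsup_le ?_ ?_
    · have hlim : Tendsto (fun N => ∫⁻ x in T N, s x ∂ν) atTop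
          (nhds (∫⁻ x in ⋃ l, A l, s x ∂ν)) := by
        rw [lintegral_iUnion hA hd]
        simp only [hsum]
        exact ENNReal.summable.hasSum.tendsto_sum_nat
      refine le_of_tendsto' hlim fun N => ?_
      rw [← (hTlim N).liminf_eq]
      exact liminf_le_liminf (.of_forall fun i => lintegral_mono_set (hTsub N))
    · have hle : ∀ M N : ℕ, M ≠ 0 → limsup (fun i => ∫⁻ x in ⋃ l, A l, f i x ∂ν) atTop ≤
          ∫⁻ x in ⋃ l, A l, s x ∂ν + (M * ν ((⋃ l, A l) \ T N) + K / M) := by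
        intro M N hM
        have h : Tendsto (fun i => ∫⁻ x in T N, f i x ∂ν + (M * ν ((⋃ l, A l) \ T N) + K / M))
            atTop (nhds (∫⁻ x in T N, s x ∂ν + (M * ν ((⋃ l, A l) \ T N) + K / M))) :=
          (hTlim N).add tendsto_const_nhds
        calc _ ≤ limsup (fun i => ∫⁻ x in T N, f i x ∂ν +
              (M * ν ((⋃ l, A l) \ T N) + K / M)) atTop := by
              refine limsup_le_limsup (.of_forall fun i => ?_)
              dsimp only
              rw [hsplit N]
              gcongr
              exact setLIntegral_le_of_pow_le hM (hfK i) _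
          _ = _ := h.limsup_eq
          _ ≤ _ := add_le_add_left (lintegral_mono_set (hTsub N)) _
      have hle' : ∀ M : ℕ, M ≠ 0 → limsup (fun i => ∫⁻ x in ⋃ l, A l, f i x ∂ν) atTop ≤
          ∫⁻ x in ⋃ l, A l, s x ∂ν + K / M := by
        intro M hM
        have h : Tendsto (fun N => ∫⁻ x in ⋃ l, A l, s x ∂ν +
            (M * ν ((⋃ l, A l) \ T N) + K / M)) atTop
            (nhds (∫⁻ x in ⋃ l, A l, s x ∂ν + (M * 0 + K / M))) :=
          tendsto_const_nhds.add ((ENNReal.Tendsto.const_mul hR (Or.inr (by simp))).add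
            tendsto_const_nhds)
        simpa using ge_of_tendsto' h fun N => hle M N hM
      have h : Tendsto (fun M : ℕ => ∫⁻ x in ⋃ l, A l, s x ∂ν + K / M) atTop
          (nhds (∫⁻ x in ⋃ l, A l, s x ∂ν + 0)) := by
        refine tendsto_const_nhds.add ?_
        simp only [div_eq_mul_inv]
        simpa using ENNReal.Tendsto.const_mul ENNReal.tendsto_inv_nat_nhds_zero (Or.inr hK)
      rw [add_zero] at h
      exact ge_of_tendsto h (Filter.eventually_atTop.2 ⟨1, fun M hM => hle' M (by omega)⟩)

lemma tendsto_lintegral_simpleFunc_mul {f : ℕ → X → ℝ≥0∞} {s : X → ℝ≥0∞}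
    (hf : ∀ i, Measurable (f i)) (hs : Measurable s)
    (h : ∀ A, MeasurableSet A →
      Tendsto (fun i => ∫⁻ x in A, f i x ∂ν) atTop (nhds (∫⁻ x in A, s x ∂ν)))
    (φ : SimpleFunc X ℝ≥0∞) (hφ : ∀ x, φ x ≠ ⊤) :
    Tendsto (fun i => ∫⁻ x, f i x * φ x ∂ν) atTop (nhds (∫⁻ x, s x * φ x ∂ν)) := by
  have e : ∀ g : X → ℝ≥0∞, Measurable g →
      ∫⁻ x, g x * φ x ∂ν = ∑ v ∈ φ.range, v * ∫⁻ x in φ ⁻¹' {v}, g x ∂ν := by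
    intro g hg
    have := lintegral_withDensity_eq_lintegral_mul ν hg φ.measurable
    rw [SimpleFunc.lintegral_eq_lintegral, SimpleFunc.lintegral] at this
    refine this.symm.trans (Finset.sum_congr rfl fun v _ => ?_)
    rw [withDensity_apply _ (φ.measurableSet_preimage {v})]
  simp only [e _ (hf _), e s hs]
  refine tendsto_finsetSum _ fun v hv => ?_
  obtain ⟨x, rfl⟩ := SimpleFunc.mem_range.1 hv
  exact ENNReal.Tendsto.const_mul (h _ (φ.measurableSet_preimage _)) (Or.inr (hφ x))

lemma lintegral_pow_le_liminf [IsFiniteMeasure ν] {f : ℕ → X → ℝ≥0∞} {s : X → ℝ≥0∞}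
    (hf : ∀ i, Measurable (f i)) (hs : Measurable s)
    (h : ∀ A, MeasurableSet A →
      Tendsto (fun i => ∫⁻ x in A, f i x ∂ν) atTop (nhds (∫⁻ x in A, s x ∂ν))) (n : ℕ) :
    ∫⁻ x, s x ^ (n + 1) ∂ν ≤ liminf (fun i => ∫⁻ x, f i x ^ (n + 1) ∂ν) atTop := by
  have key : ∀ l, ∫⁻ x, SimpleFunc.eapprox s l x ^ (n + 1) ∂ν ≤
      liminf (fun i => ∫⁻ x, f i x ^ (n + 1) ∂ν) atTop := by
    intro l
    set φ := SimpleFunc.eapprox s l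
    have hφtop : ∀ x, φ x ≠ ⊤ := fun x => (SimpleFunc.eapprox_lt_top s l x).ne
    have hφs : ∀ x, φ x ≤ s x := fun x => by
      rw [← SimpleFunc.iSup_eapprox_apply hs]
      exact le_iSup (fun l => SimpleFunc.eapprox s l x) l
    have hφm : Measurable φ := φ.measurable
    have hφint : ∫⁻ x, φ x ^ (n + 1) ∂ν ≠ ⊤ := by
      have e := SimpleFunc.lintegral_eq_lintegral (φ.map fun v => v ^ (n + 1)) ν
      simp only [SimpleFunc.map_apply] at e
      change ∫⁻ x, φ x ^ (n + 1) ∂ν = _ at e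
      rw [e, SimpleFunc.map_lintegral]
      refine ENNReal.sum_ne_top.2 fun v hv => ?_
      obtain ⟨x, rfl⟩ := SimpleFunc.mem_range.1 hv
      exact ENNReal.mul_ne_top (ENNReal.pow_ne_top (hφtop x)) (measure_ne_top _ _)
    have hlim := tendsto_lintegral_simpleFunc_mul hf hs h
      (φ.map fun v => (n + 1 : ℝ≥0∞) * v ^ n) fun x =>
        ENNReal.mul_ne_top (by finiteness) (ENNReal.pow_ne_top (hφtop x))
    have hfin : (n : ℝ≥0∞) * ∫⁻ x, φ x ^ (n + 1) ∂ν ≠ ⊤ :=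
      ENNReal.mul_ne_top (by finiteness) hφint
    refine (ENNReal.add_le_add_iff_right hfin).1 ?_
    calc ∫⁻ x, φ x ^ (n + 1) ∂ν + n * ∫⁻ x, φ x ^ (n + 1) ∂ν
        = ∫⁻ x, (n + 1) * φ x ^ (n + 1) ∂ν := by
          rw [lintegral_const_mul _ (by fun_prop)]
          ring
      _ ≤ ∫⁻ x, s x * ((n + 1) * φ x ^ n) ∂ν := lintegral_mono fun x => by
          calc (n + 1) * φ x ^ (n + 1) = φ x * ((n + 1) * φ x ^ n) := by ring
            _ ≤ _ := mul_le_mul' (hφs x) le_rfl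
      _ = liminf (fun i => ∫⁻ x, f i x * ((n + 1) * φ x ^ n) ∂ν) atTop := hlim.liminf_eq.symm
      _ ≤ liminf (fun i => ∫⁻ x, f i x ^ (n + 1) ∂ν + n * ∫⁻ x, φ x ^ (n + 1) ∂ν) atTop := by
          refine liminf_le_liminf (.of_forall fun i => ?_)
          rw [← lintegral_const_mul _ (by fun_prop), ← lintegral_add_left ((hf i).pow_const _)]
          refine lintegral_mono fun x => ?_
          have := ENNReal.young_pow n (f i x) (φ x)
          rwa [mul_comm (f i x)]
      _ = _ := _root_.liminf_add_const _ _ _ (by isBoundedDefault) (by isBoundedDefault)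
  have hmono := lintegral_tendsto_of_tendsto_of_monotone (μ := ν)
    (f := fun l x => SimpleFunc.eapprox s l x ^ (n + 1)) (F := fun x => s x ^ (n + 1))
    (fun l => ((SimpleFunc.eapprox s l).measurable.pow_const _).aemeasurable)
    (.of_forall fun x a b hab => pow_le_pow_left' (SimpleFunc.monotone_eapprox s hab x) _)
    (.of_forall fun x => ?_)
  · exact le_of_tendsto' hmono key
  · refine ((ENNReal.continuous_pow (n + 1)).tendsto _).comp ?_
    rw [← SimpleFunc.iSup_eapprox_apply hs x]
    exact tendsto_atTop_iSup fun a b hab => SimpleFunc.monotone_eapprox s hab x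

end WeakLimit

section StarConvergence

variable {η : Measure (J × J)} {π : Measure J} {P : Kernel J J}

lemma avgStar_eq_lintegral {m : ℕ} {c : J → Fin m} (hc : Measurable c) {ι : Type*}
    (ψ : Kernel (ι → J) J) {B : Set J} (hB : MeasurableSet B) (x : ι → J) :
    avgStar π c ψ B x = ∫⁻ y, cellAvg π c (B.indicator 1) (c y) ∂(ψ x) := by
  rw [lintegral_comp_cells _ hc]
  exact Finset.sum_congr rfl fun j _ => by rw [cellAvg_indicator π hB]

lemma avgStar_le {m : ℕ} {c : J → Fin m} (hc : Measurable c) {ι : Type*}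
    (ψ : Kernel (ι → J) J) {B : Set J} (hB : MeasurableSet B) (x : ι → J) :
    avgStar π c ψ B x ≤ ψ x Set.univ := by
  rw [avgStar_eq_lintegral hc ψ hB]
  calc _ ≤ ∫⁻ _, 1 ∂(ψ x) := lintegral_mono fun y =>
        cellAvg_le_one π (fun x => Set.indicator_le_self' (fun _ _ => zero_le) x) _
    _ = _ := by simp

lemma IsStarDisint.ae_ae [IsProbabilityMeasure π] {ι : Type*} [Fintype ι]
    {ψ : Kernel (ι → J) J} (hψ : IsStarDisint π P ψ) {q : J → Prop} (hq : ∀ᵐ y ∂π, q y) :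
    ∀ᵐ x ∂(Measure.pi fun _ : ι => π), ∀ᵐ y ∂(ψ x), q y := by
  obtain ⟨N, hN, hNm, hN0⟩ := exists_measurable_superset_of_null (ae_iff.1 hq)
  have h := hψ.2 Set.univ N MeasurableSet.univ hNm
  rw [Measure.restrict_univ, setLIntegral_measure_zero _ _ hN0,
    lintegral_eq_zero_iff (Kernel.measurable_coe ψ hNm)] at h
  filter_upwards [h] with x hx
  exact measure_mono_null hN hx

variable {m : ℕ → ℕ} {c : ∀ i, J → Fin (m i)}

lemma IsExhausting.tendsto_avgStar [IsProbabilityMeasure π] (hex : IsExhausting π c)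
    {ι : Type*} [Fintype ι] {ψ : Kernel (ι → J) J} (hψ : IsStarDisint π P ψ) {B : Set J}
    (hB : MeasurableSet B) :
    ∀ᵐ x ∂(Measure.pi fun _ : ι => π),
      Tendsto (fun i => avgStar π (c i) ψ B x) atTop (nhds (ψ x B)) := by
  have hI1 : ∀ x, B.indicator (1 : J → ℝ≥0∞) x ≤ 1 := fun x =>
    Set.indicator_le_self' (fun _ _ => zero_le) x
  filter_upwards [hψ.ae_ae (hex.tendsto_cellAvg (measurable_one.indicator hB) hI1)] with x hx
  have := hψ.1 x
  simp only [avgStar_eq_lintegral (hex.measurable _) ψ hB]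
  rw [← lintegral_indicator_one hB]
  exact tendsto_lintegral_of_dominated_convergence (fun _ => 1)
    (fun i => measurable_of_cells (hex.measurable i) _)
    (fun i => .of_forall fun y => cellAvg_le_one π hI1 _)
    (by rw [lintegral_const]; finiteness) hx

/-- The star densities of an exhausting partition sequence converge in `L^p`. -/
lemma IsExhausting.exists_tendsto_starDensity [IsFiniteMeasure η] [IsProbabilityMeasure π]
    [IsMarkovKernel P] (hex : IsExhausting π c) (h : IsReversibleDisint η π P)
    {ι : Type*} [Fintype ι] {ψ : Kernel (ι → J) J} (hψ : IsStarDisint π P ψ) {B : Set J}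
    (hB : MeasurableSet B) (n : ℕ)
    (hS : ∫⁻ x, ψ x Set.univ ^ (n + 2) ∂(Measure.pi fun _ : ι => π) < ⊤) :
    ∃ D : ℕ → (ι → J) → ℝ≥0∞, (∀ i, Measurable (D i)) ∧
      (∀ i x, starDensity η π (c i) ι B x ≤ ψ x B + D i x) ∧
      (∀ i x, ψ x B ≤ starDensity η π (c i) ι B x + D i x) ∧
      Tendsto (fun i => ∫⁻ x, D i x ^ (n + 2) ∂(Measure.pi fun _ : ι => π)) atTop (nhds 0) := by
  set ν := Measure.pi fun _ : ι => π with hν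
  have hf : ∀ i, Measurable (starDensity η π (c i) ι B) := fun i =>
    measurable_starDensity (hex.measurable i) ι B
  have ha : ∀ i, Measurable (avgStar π (c i) ψ B) := fun i =>
    measurable_avgStar (hex.measurable i) ψ B
  have hs : Measurable fun x => ψ x B := Kernel.measurable_coe ψ hB
  have haS := fun i => avgStar_le (π := π) (hex.measurable i) ψ hB
  have hsS : ∀ x, ψ x B ≤ ψ x Set.univ := fun x => measure_mono (Set.subset_univ _)
  have hT : Tendsto (fun i => ∫⁻ x, avgStar π (c i) ψ B x ^ (n + 2) ∂ν) atTop
      (nhds (∫⁻ x, ψ x B ^ (n + 2) ∂ν)) := by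
    refine tendsto_lintegral_of_dominated_convergence (fun x => ψ x Set.univ ^ (n + 2))
      (fun i => (ha i).pow_const _) (fun i => .of_forall fun x => pow_le_pow_left' (haS i x) _)
      hS.ne ?_
    filter_upwards [hex.tendsto_avgStar hψ hB] with x hx
    exact ((ENNReal.continuous_pow (n + 2)).tendsto _).comp hx
  have hA : Tendsto (fun i => ∫⁻ x, (avgStar π (c i) ψ B x - ψ x B +
      (ψ x B - avgStar π (c i) ψ B x)) ^ (n + 2) ∂ν) atTop (nhds 0) := by
    have := tendsto_lintegral_of_dominated_convergence (μ := ν)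
      (F := fun i x => (avgStar π (c i) ψ B x - ψ x B +
        (ψ x B - avgStar π (c i) ψ B x)) ^ (n + 2)) (f := fun _ => 0)
      (fun x => (2 * ψ x Set.univ) ^ (n + 2))
      (fun i => (((ha i).sub hs).add (hs.sub (ha i))).pow_const _)
      (fun i => .of_forall fun x => pow_le_pow_left' ?_ _) ?_ ?_
    · simpa using this
    · rw [two_mul]
      exact add_le_add (tsub_le_self.trans (haS i x)) (tsub_le_self.trans (hsS x))
    · simp only [mul_pow]
      rw [lintegral_const_mul' _ _ (by finiteness)]
      exact ENNReal.mul_ne_top (by finiteness) hS.ne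
    · filter_upwards [hex.tendsto_avgStar hψ hB] with x hx
      have := hψ.1 x
      have h0 := ENNReal.tendsto_dist_zero (measure_ne_top _ _) hx
      simpa [Function.comp_def] using ((ENNReal.continuous_pow (n + 2)).tendsto _).comp h0
  have hdist := fun i =>
    lintegral_dist_starDensity_pow_add_le h (hex.measurable i) (hex.ne_zero i) hψ B n
  have hfS : ∀ i, ∫⁻ x, starDensity η π (c i) ι B x ^ (n + 2) ∂ν ≤
      ∫⁻ x, ψ x Set.univ ^ (n + 2) ∂ν := fun i =>
    (le_add_self.trans (hdist i)).trans (lintegral_mono fun x => pow_le_pow_left' (haS i x) _)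
  have hsint : ∫⁻ x, ψ x B ∂ν ≠ ⊤ := by
    have := hψ.2 Set.univ B MeasurableSet.univ hB
    simp only [Measure.restrict_univ, measure_univ, lintegral_one] at this
    rw [this]
    exact measure_ne_top _ _
  have hset : ∀ A, MeasurableSet A → Tendsto (fun i => ∫⁻ x in A, starDensity η π (c i) ι B x ∂ν)
      atTop (nhds (∫⁻ x in A, ψ x B ∂ν)) := fun A hA =>
    tendsto_setLIntegral_of_isPiSystem hS.ne hsint hfS
      (generateFrom_pi (α := fun _ : ι => J)).symm isPiSystem_pi
      ⟨fun _ => Set.univ, by simp, Set.pi_univ _⟩ (by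
        rintro _ ⟨A, hA, rfl⟩
        exact hex.tendsto_setLIntegral_pi_starDensity h hψ hB A fun u => hA u (Set.mem_univ u)) hA
  have hE : Tendsto (fun i => ∫⁻ x, starDensity η π (c i) ι B x ^ (n + 2) ∂ν) atTop
      (nhds (∫⁻ x, ψ x B ^ (n + 2) ∂ν)) := by
    refine tendsto_of_le_liminf_of_limsup_le (lintegral_pow_le_liminf hf hs hset (n + 1)) ?_
    rw [← hT.limsup_eq]
    exact limsup_le_limsup (.of_forall fun i => le_add_self.trans (hdist i))
  have hL : ∫⁻ x, ψ x B ^ (n + 2) ∂ν ≠ ⊤ :=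
    ((lintegral_mono fun x => pow_le_pow_left' (hsS x) _).trans_lt hS).ne
  have hF : Tendsto (fun i => ∫⁻ x, ((avgStar π (c i) ψ B x - starDensity η π (c i) ι B x) +
      (starDensity η π (c i) ι B x - avgStar π (c i) ψ B x)) ^ (n + 2) ∂ν) atTop (nhds 0) := by
    have h1 := ENNReal.Tendsto.sub hT hE (Or.inl hL)
    rw [tsub_self] at h1
    refine tendsto_of_tendsto_of_tendsto_of_le_of_le tendsto_const_nhds h1 (fun _ => zero_le)
      fun i => ?_
    exact ENNReal.le_sub_of_add_le_right ((hfS i).trans_lt hS).ne (hdist i)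
  have hm1 : ∀ i, Measurable fun x => (avgStar π (c i) ψ B x - starDensity η π (c i) ι B x) +
      (starDensity η π (c i) ι B x - avgStar π (c i) ψ B x) := fun i =>
    ((ha i).sub (hf i)).add ((hf i).sub (ha i))
  have hm2 : ∀ i, Measurable fun x => avgStar π (c i) ψ B x - ψ x B +
      (ψ x B - avgStar π (c i) ψ B x) := fun i => ((ha i).sub hs).add (hs.sub (ha i))
  refine ⟨fun i x => ((avgStar π (c i) ψ B x - starDensity η π (c i) ι B x) +
      (starDensity η π (c i) ι B x - avgStar π (c i) ψ B x)) +
      (avgStar π (c i) ψ B x - ψ x B + (ψ x B - avgStar π (c i) ψ B x)),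
    fun i => (hm1 i).add (hm2 i), fun i x => ?_, fun i x => ?_, ?_⟩
  · refine (ENNReal.le_add_dist' (avgStar π (c i) ψ B x) _).trans ?_
    refine (add_le_add_left (ENNReal.le_add_dist _ (ψ x B)) _).trans (le_of_eq ?_)
    ring
  · refine (ENNReal.le_add_dist' (avgStar π (c i) ψ B x) _).trans ?_
    refine (add_le_add_left (ENNReal.le_add_dist _ (starDensity η π (c i) ι B x)) _).trans
      (le_of_eq ?_)
    ring
  · have hlim : Tendsto (fun i => 2 ^ (n + 2) *
        (∫⁻ x, ((avgStar π (c i) ψ B x - starDensity η π (c i) ι B x) +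
          (starDensity η π (c i) ι B x - avgStar π (c i) ψ B x)) ^ (n + 2) ∂ν +
        ∫⁻ x, (avgStar π (c i) ψ B x - ψ x B +
          (ψ x B - avgStar π (c i) ψ B x)) ^ (n + 2) ∂ν)) atTop (nhds (2 ^ (n + 2) * (0 + 0))) :=
      ENNReal.Tendsto.const_mul (hF.add hA) (Or.inr (by finiteness))
    rw [add_zero, mul_zero] at hlim
    refine tendsto_of_tendsto_of_tendsto_of_le_of_le tendsto_const_nhds hlim (fun _ => zero_le)
      fun i => ?_
    dsimp only
    rw [← lintegral_add_left ((hm1 i).pow_const _), ← lintegral_const_mul' _ _ (by finiteness)]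
    exact lintegral_mono fun x => ENNReal.add_pow_le_two_pow _ _ _

end StarConvergence

section Looseness

variable {π : Measure J} {P : Kernel J J}

lemma measurePreserving_pi_comp {ι κ : Type*} [Fintype ι] [Fintype κ] (μ : Measure J)
    [IsProbabilityMeasure μ] {e : ι → κ} (he : Function.Injective e) :
    MeasurePreserving (fun (x : κ → J) u => x (e u)) (Measure.pi fun _ => μ)
      (Measure.pi fun _ => μ) := by
  refine ⟨measurable_pi_lambda _ fun u => measurable_pi_apply (e u), ?_⟩
  have h := iIndepFun_pi (μ := fun _ : κ => μ) (X := fun _ (x : J) => x)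
    fun _ => measurable_id.aemeasurable
  have h' := (iIndepFun_iff_map_fun_eq_pi_map
    fun u => (measurable_pi_apply (e u)).aemeasurable).1 (h.precomp he)
  refine h'.trans ?_
  congr 1
  funext u
  exact (measurePreserving_eval (fun _ : κ => μ) (e u)).map_eq

lemma KLoose.lintegral_stepDensityIdx_mul [IsProbabilityMeasure π] [IsMarkovKernel P] {k : ℕ}
    (h : KLoose π P k) {φ : (Fin k → J) → ℝ≥0∞} (hφ : Measurable φ) :
    ∫⁻ x, stepDensityIdx π P (Fin k) x * φ x ∂(Measure.pi fun _ : Fin k => π) =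
      ∫⁻ y, ∫⁻ x, φ x ∂(Measure.pi fun _ : Fin k => P y) ∂π := by
  have hm := measurable_measure_pi P (Fin k)
  have : IsFiniteMeasure (stepMeasureIdx π P (Fin k)) := by
    refine ⟨?_⟩
    rw [stepMeasureIdx, Measure.bind_apply MeasurableSet.univ hm.aemeasurable]
    simp
  have e : (Measure.pi fun _ : Fin k => π).withDensity (stepDensityIdx π P (Fin k)) =
      stepMeasureIdx π P (Fin k) := Measure.withDensity_rnDeriv_eq _ _ h
  have h1 := lintegral_withDensity_eq_lintegral_mul (Measure.pi fun _ : Fin k => π)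
    (Measure.measurable_rnDeriv (stepMeasureIdx π P (Fin k)) (Measure.pi fun _ : Fin k => π)) hφ
  rw [← Measure.lintegral_bind hm.aemeasurable hφ.aemeasurable]
  refine h1.symm.trans ?_
  change ∫⁻ x, φ x ∂((Measure.pi fun _ : Fin k => π).withDensity
    (stepDensityIdx π P (Fin k))) = _
  rw [e]
  rfl

/-- The mass of the common-neighbour measure of at most `k` points is in `L^p`. -/
lemma KPLoose.lintegral_pow_lt_top [IsProbabilityMeasure π] [IsMarkovKernel P] {k q : ℕ}
    (h : KPLoose π P k (q + 1)) {ι : Type*} [Fintype ι] (hι : Fintype.card ι ≤ k)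
    {ψ : Kernel (ι → J) J} (hψ : IsStarDisint π P ψ) :
    ∫⁻ x, ψ x Set.univ ^ (q + 1) ∂(Measure.pi fun _ : ι => π) < ⊤ := by
  obtain ⟨e⟩ : Nonempty (ι ↪ Fin k) := Function.Embedding.nonempty_of_card_le (by simpa using hι)
  set K := ∫⁻ x, stepDensityIdx π P (Fin k) x ^ (q + 1) ∂(Measure.pi fun _ : Fin k => π)
  have hs : Measurable (stepDensityIdx π P (Fin k)) := Measure.measurable_rnDeriv _ _
  have hψm : Measurable fun x => ψ x Set.univ := Kernel.measurable_coe ψ MeasurableSet.univ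
  have hr := measurePreserving_pi_comp π e.injective
  have key : ∀ N : ℕ, ∫⁻ x, min (ψ x Set.univ) N ^ (q + 1) ∂(Measure.pi fun _ : ι => π) ≤ K := by
    intro N
    set g : (ι → J) → ℝ≥0∞ := fun x => min (ψ x Set.univ) N with hg
    have hgm : Measurable g := hψm.min measurable_const
    have hfin : ∫⁻ x, g x ^ (q + 1) ∂(Measure.pi fun _ : ι => π) ≠ ⊤ := by
      refine ((lintegral_mono fun x => pow_le_pow_left' (min_le_right _ _) _).trans_lt
        (?_ : ∫⁻ _, (N : ℝ≥0∞) ^ (q + 1) ∂(Measure.pi fun _ : ι => π) < ⊤)).ne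
      rw [lintegral_const]
      finiteness
    have hgr : Measurable fun x : Fin k → J => g (fun u => x (e u)) ^ q :=
      (hgm.comp hr.measurable).pow_const q
    have h1 : ∫⁻ x, ψ x Set.univ * g x ^ q ∂(Measure.pi fun _ : ι => π) =
        ∫⁻ x, stepDensityIdx π P (Fin k) x * g (fun u => x (e u)) ^ q
          ∂(Measure.pi fun _ : Fin k => π) := by
      rw [hψ.lintegral_mul MeasurableSet.univ (hgm.pow_const q), Measure.restrict_univ,
        h.1.lintegral_stepDensityIdx_mul hgr]
      refine lintegral_congr fun y => ?_
      exact ((measurePreserving_pi_comp (P y) e.injective).lintegral_comp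
        (hgm.pow_const q)).symm
    have hfin' : (q : ℝ≥0∞) * ∫⁻ x, g x ^ (q + 1) ∂(Measure.pi fun _ : ι => π) ≠ ⊤ :=
      ENNReal.mul_ne_top (by finiteness) hfin
    refine (ENNReal.add_le_add_iff_right hfin').1 ?_
    calc ∫⁻ x, g x ^ (q + 1) ∂(Measure.pi fun _ : ι => π) +
          q * ∫⁻ x, g x ^ (q + 1) ∂(Measure.pi fun _ : ι => π)
        = (q + 1) * ∫⁻ x, g x * g x ^ q ∂(Measure.pi fun _ : ι => π) := by
          simp only [pow_succ']
          ring
      _ ≤ (q + 1) * ∫⁻ x, ψ x Set.univ * g x ^ q ∂(Measure.pi fun _ : ι => π) := by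
          gcongr with x
          exact min_le_left _ _
      _ = ∫⁻ x, (q + 1) * g (fun u => x (e u)) ^ q * stepDensityIdx π P (Fin k) x
          ∂(Measure.pi fun _ : Fin k => π) := by
          rw [h1, ← lintegral_const_mul' _ _ (by finiteness)]
          refine lintegral_congr fun x => ?_
          ring
      _ ≤ ∫⁻ x, (stepDensityIdx π P (Fin k) x ^ (q + 1) +
          q * g (fun u => x (e u)) ^ (q + 1)) ∂(Measure.pi fun _ : Fin k => π) :=
          lintegral_mono fun x => ENNReal.young_pow q _ _
      _ = K + q * ∫⁻ x, g x ^ (q + 1) ∂(Measure.pi fun _ : ι => π) := by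
          rw [lintegral_add_left (hs.pow_const _), lintegral_const_mul' _ _ (by finiteness),
            hr.lintegral_comp (hgm.pow_const (q + 1))]
  have hmono := lintegral_tendsto_of_tendsto_of_monotone (μ := Measure.pi fun _ : ι => π)
    (f := fun (N : ℕ) x => min (ψ x Set.univ) N ^ (q + 1)) (F := fun x => ψ x Set.univ ^ (q + 1))
    (fun N => ((hψm.min measurable_const).pow_const _).aemeasurable)
    (.of_forall fun x a b hab => pow_le_pow_left'
      (min_le_min_left _ (Nat.cast_le.2 hab)) _)
    (.of_forall fun x => ?_)
  · exact (le_of_tendsto' hmono key).trans_lt h.2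
  · have := hψ.1 x
    obtain ⟨N, hN⟩ := ENNReal.exists_nat_gt (measure_ne_top (ψ x) Set.univ)
    refine tendsto_const_nhds.congr' (Filter.eventually_atTop.2 ⟨N, fun M hM => ?_⟩)
    dsimp only
    rw [min_eq_left (hN.le.trans (Nat.cast_le.2 hM))]

end Looseness

section DisjointStars

lemma update_comp_val {X V : Type*} [DecidableEq V] {N : Finset V} {u : V} (hu : u ∉ N)
    (x : V → X) (y : X) : (fun v : ↥N => Function.update x u y v.1) = fun v => x v.1 :=
  funext fun v => Function.update_of_ne (ne_of_mem_of_not_mem v.2 hu) y x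

lemma dependsOn_finsetProd {X V κ : Type*} [DecidableEq V] [DecidableEq κ] (T : Finset κ)
    (N : κ → Finset V) {G : κ → (V → X) → ℝ≥0∞} (hGN : ∀ w, DependsOn (G w) (N w)) :
    DependsOn (fun x => ∏ w ∈ T, G w x) (T.biUnion N) := by
  intro x y hxy
  refine Finset.prod_congr rfl fun w hw => hGN w fun u hu => hxy u ?_
  exact Finset.mem_coe.2 (Finset.mem_biUnion.2 ⟨w, hw, hu⟩)

variable {U : Type*} [Fintype U] [DecidableEq U]

lemma lintegral_mul_of_dependsOn (π : Measure J) [IsProbabilityMeasure π] {S T : Finset U}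
    (hST : Disjoint S T) {F H : (U → J) → ℝ≥0∞} (hF : Measurable F) (hH : Measurable H)
    (hFS : DependsOn F S) (hHT : DependsOn H T) :
    ∫⁻ x, F x * H x ∂(Measure.pi fun _ : U => π) =
      (∫⁻ x, F x ∂(Measure.pi fun _ : U => π)) * ∫⁻ x, H x ∂(Measure.pi fun _ : U => π) := by
  obtain ⟨x₀⟩ : Nonempty J := nonempty_of_isProbabilityMeasure π
  let ext (R : Finset U) (z : R → J) : U → J := fun u => if h : u ∈ R then z ⟨u, h⟩ else x₀
  have hext : ∀ R, Measurable (ext R) := by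
    refine fun R => measurable_pi_lambda _ fun u => ?_
    by_cases h : u ∈ R
    · simpa [ext, h] using measurable_pi_apply (⟨u, h⟩ : R)
    · simp [ext, h]
  have hind := iIndepFun_pi (μ := fun _ : U => π) (X := fun _ (x : J) => x)
    fun _ => measurable_id.aemeasurable
  have h := (hind.indepFun_finset S T hST fun u => measurable_pi_apply u).comp
    (hF.comp (hext S)) (hH.comp (hext T))
  have eF : (F ∘ ext S) ∘ (fun (x : U → J) (i : S) => x i) = F :=
    funext fun x => hFS fun u hu => by simp [ext, Finset.mem_coe.1 hu]
  have eH : (H ∘ ext T) ∘ (fun (x : U → J) (i : T) => x i) = H :=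
    funext fun x => hHT fun u hu => by simp [ext, Finset.mem_coe.1 hu]
  rw [eF, eH] at h
  exact lintegral_mul_eq_lintegral_mul_lintegral_of_indepFun hF hH h

lemma lintegral_prod_of_dependsOn (π : Measure J) [IsProbabilityMeasure π] {κ : Type*}
    [DecidableEq κ] (T : Finset κ) (N : κ → Finset U)
    (hN : ∀ v w, v ≠ w → Disjoint (N v) (N w)) {G : κ → (U → J) → ℝ≥0∞}
    (hG : ∀ w, Measurable (G w)) (hGN : ∀ w, DependsOn (G w) (N w)) :
    ∫⁻ x, ∏ w ∈ T, G w x ∂(Measure.pi fun _ : U => π) =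
      ∏ w ∈ T, ∫⁻ x, G w x ∂(Measure.pi fun _ : U => π) := by
  induction T using Finset.induction_on with
  | empty => simp
  | insert v T hv ih =>
    simp only [Finset.prod_insert hv]
    rw [lintegral_mul_of_dependsOn π (S := N v) (T := T.biUnion N) ?_ (hG v)
      (Finset.measurable_prod _ fun w _ => hG w) (hGN v) (dependsOn_finsetProd T N hGN), ih]
    refine (Finset.disjoint_biUnion_right _ _ _).2 fun w hw => hN v w ?_
    rintro rfl
    exact hv hw

/-- For disjoint neighbourhoods, the integral over a box factorizes. -/
lemma exists_setLIntegral_prod_eq (π : Measure J) [IsProbabilityMeasure π] {κ : Type*} [Fintype κ]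
    [DecidableEq κ] (N : κ → Finset U) (hN : ∀ v w, v ≠ w → Disjoint (N v) (N w))
    (A : U → Set J) (hA : ∀ u, MeasurableSet (A u)) :
    ∃ C : ℝ≥0∞, C ≠ ⊤ ∧ ∀ g : ∀ w, (↥(N w) → J) → ℝ≥0∞, (∀ w, Measurable (g w)) →
      ∫⁻ x in Set.univ.pi A, ∏ w, g w (fun u => x u.1) ∂(Measure.pi fun _ : U => π) =
        C * ∏ w, ∫⁻ z in Set.univ.pi fun u : ↥(N w) => A u.1, g w z
          ∂(Measure.pi fun _ : ↥(N w) => π) := by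
  set R : Finset U := Finset.univ \ Finset.univ.biUnion N with hR
  set I : (U → J) → ℝ≥0∞ := (Set.pi (R : Set U) A).indicator 1 with hI
  have hmeasR : MeasurableSet (Set.pi (R : Set U) A) :=
    MeasurableSet.pi R.countable_toSet fun u _ => hA u
  refine ⟨∫⁻ x, I x ∂(Measure.pi fun _ : U => π), ?_, fun g hg => ?_⟩
  · rw [hI, lintegral_indicator_one hmeasR]
    exact measure_ne_top _ _
  have hbox : ∀ w, MeasurableSet (Set.univ.pi fun u : ↥(N w) => A u.1) := fun w =>
    MeasurableSet.univ_pi fun u => hA u.1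
  have hr : ∀ w, MeasurePreserving (fun (x : U → J) (u : ↥(N w)) => x u.1)
      (Measure.pi fun _ => π) (Measure.pi fun _ => π) := fun w =>
    measurePreserving_pi_comp π Subtype.val_injective
  set G : κ → (U → J) → ℝ≥0∞ := fun w x =>
    (Set.univ.pi fun u : ↥(N w) => A u.1).indicator (g w) (fun u => x u.1) with hG
  have hGm : ∀ w, Measurable (G w) := fun w => ((hg w).indicator (hbox w)).comp (hr w).measurable
  have hGN : ∀ w, DependsOn (G w) (N w) := fun w x y hxy => by
    have : (fun u : ↥(N w) => x u.1) = fun u => y u.1 := funext fun u => hxy u.1 u.2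
    simp only [hG, this]
  have hIR : DependsOn I R := fun x y hxy => by
    have : x ∈ Set.pi (R : Set U) A ↔ y ∈ Set.pi (R : Set U) A :=
      forall₂_congr fun u hu => by rw [hxy u hu]
    by_cases hx : x ∈ Set.pi (R : Set U) A
    · simp [hI, hx, this.1 hx]
    · simp [hI, hx, mt this.2 hx]
  have hsplit : ∀ x, (Set.univ.pi A).indicator (fun x : U → J => ∏ w, g w fun u => x u.1) x =
      I x * ∏ w, G w x := by
    intro x
    by_cases hx : x ∈ Set.univ.pi A
    · have h1 : x ∈ Set.pi (R : Set U) A := fun u _ => hx u (Set.mem_univ u)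
      rw [Set.indicator_of_mem hx, hI, Set.indicator_of_mem h1, Pi.one_apply, one_mul]
      refine Finset.prod_congr rfl fun w _ => ?_
      have h2 : (fun u : ↥(N w) => x u.1) ∈ Set.univ.pi fun u : ↥(N w) => A u.1 :=
        fun u _ => hx u.1 (Set.mem_univ _)
      exact (Set.indicator_of_mem h2 _).symm
    · rw [Set.indicator_of_notMem hx]
      by_cases h1 : x ∈ Set.pi (R : Set U) A
      · obtain ⟨u, hu⟩ : ∃ u, x u ∉ A u := by simpa [Set.mem_pi] using hx
        have huR : u ∉ R := fun h => hu (h1 u h)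
        obtain ⟨w, hw⟩ : ∃ w, u ∈ N w := by simpa [hR] using huR
        rw [Finset.prod_eq_zero (Finset.mem_univ w), mul_zero]
        have h2 : (fun u : ↥(N w) => x u.1) ∉ Set.univ.pi fun u : ↥(N w) => A u.1 :=
          fun h => hu (h ⟨u, hw⟩ (Set.mem_univ _))
        exact Set.indicator_of_notMem h2 _
      · rw [hI, Set.indicator_of_notMem h1, zero_mul]
  rw [← lintegral_indicator (MeasurableSet.univ_pi hA)]
  simp only [hsplit]
  rw [lintegral_mul_of_dependsOn π (S := R) (T := Finset.univ.biUnion N) Finset.sdiff_disjoint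
    (measurable_one.indicator hmeasR) (Finset.measurable_prod _ fun w _ => hGm w) hIR
    (dependsOn_finsetProd _ N hGN), lintegral_prod_of_dependsOn π _ N hN hGm hGN]
  congr 1
  refine Finset.prod_congr rfl fun w _ => ?_
  rw [(hr w).lintegral_comp ((hg w).indicator (hbox w)), lintegral_indicator (hbox w)]

end DisjointStars

section BoxFormulas

variable {U W' : Type*} [Fintype U] [Fintype W'] [DecidableEq U] [DecidableEq W']

lemma homMeasure_box (π : Measure J) [IsProbabilityMeasure π] (E : Finset (U × W'))
    (ψ : ∀ w : W', Kernel (↥(nbrW E w) → J) J) (hψ : ∀ w x, IsFiniteMeasure (ψ w x))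
    {A : U → Set J} {B : W' → Set J} (hA : ∀ u, MeasurableSet (A u))
    (hB : ∀ w, MeasurableSet (B w)) :
    homMeasure π E ψ (Set.univ.pi A ×ˢ Set.univ.pi B) =
      ∫⁻ x in Set.univ.pi A, ∏ w, ψ w (fun u => x u.1) (B w) ∂(Measure.pi fun _ : U => π) := by
  have hr : ∀ w, Measurable fun (x : U → J) (u : ↥(nbrW E w)) => x u.1 := fun w =>
    measurable_pi_lambda _ fun u => measurable_pi_apply u.1
  have hcoe : ∀ w {C : Set J}, MeasurableSet C →
      Measurable fun x : U → J => ψ w (fun u => x u.1) C := fun w C hC =>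
    (Kernel.measurable_coe (ψ w) hC).comp (hr w)
  have hpi : Measurable fun x : U → J =>
      Measure.pi fun w : W' => ψ w fun u => x u.1 := by
    refine Measurable.measure_of_isPiSystem (generateFrom_pi (α := fun _ : W' => J)).symm
      isPiSystem_pi ?_ ?_
    · rintro _ ⟨C, hC, rfl⟩
      simp only [Measure.pi_pi]
      exact Finset.measurable_prod _ fun w _ => hcoe w (hC w (Set.mem_univ w))
    · simp only [Measure.pi_univ]
      exact Finset.measurable_prod _ fun w _ => hcoe w MeasurableSet.univ
  have hrect : ∀ {S : Set (U → J)} {T : Set (W' → J)}, MeasurableSet S → MeasurableSet T →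
      Measurable fun x : U → J => ((Measure.dirac x).prod
        (Measure.pi fun w : W' => ψ w fun u => x u.1)) (S ×ˢ T) := by
    intro S T hS hT
    simp only [Measure.prod_prod, Measure.dirac_apply' _ hS]
    exact (measurable_one.indicator hS).mul ((Measure.measurable_coe hT).comp hpi)
  have hprod : Measurable fun x : U → J => (Measure.dirac x).prod
      (Measure.pi fun w : W' => ψ w fun u => x u.1) := by
    refine Measurable.measure_of_isPiSystem generateFrom_prod.symm isPiSystem_prod ?_ ?_
    · rintro _ ⟨S, hS, T, hT, rfl⟩
      exact hrect hS hT
    · rw [← Set.univ_prod_univ]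
      exact hrect MeasurableSet.univ MeasurableSet.univ
  rw [homMeasure, Measure.bind_apply ((MeasurableSet.univ_pi hA).prod (MeasurableSet.univ_pi hB))
    hprod.aemeasurable, ← lintegral_indicator (MeasurableSet.univ_pi hA)]
  refine lintegral_congr fun x => ?_
  rw [Measure.prod_prod, Measure.dirac_apply' _ (MeasurableSet.univ_pi hA), Measure.pi_pi]
  by_cases hx : x ∈ Set.univ.pi A <;> simp [hx]

lemma stepBoxVal_eq (η : Measure (J × J)) [IsProbabilityMeasure (η.map Prod.fst)] {m : ℕ}
    {c : J → Fin m} (hc : Measurable c) (E : Finset (U × W')) (A : U → Set J) {B : W' → Set J}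
    (hB : ∀ w, MeasurableSet (B w)) :
    stepBoxVal η c E A B = ∫⁻ x in Set.univ.pi A,
      ∏ w, starDensity η (η.map Prod.fst) c ↥(nbrW E w) (B w) (fun u => x u.1)
        ∂(Measure.pi fun _ : U => η.map Prod.fst) := by
  unfold stepBoxVal
  refine lintegral_congr fun x => ?_
  have hE : ∀ y : W' → J, ∏ e ∈ E, stepW η c (x e.1) (y e.2) =
      ∏ w, ∏ u : ↥(nbrW E w), cellDensity η (η.map Prod.fst) c (c (x u.1)) (c (y w)) := by
    intro y
    rw [Finset.prod_finset_product_right' E Finset.univ (nbrW E) (by simp [nbrW])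
      (f := fun u w => stepW η c (x u) (y w))]
    exact Finset.prod_congr rfl fun w _ => (Finset.prod_coe_sort (nbrW E w) _).symm
  simp only [hE]
  rw [setLIntegral_pi_prod _ B hB (fun w z => ∏ u : ↥(nbrW E w),
    cellDensity η (η.map Prod.fst) c (c (x u.1)) (c z)) fun w =>
      measurable_of_cells hc fun j => ∏ u : ↥(nbrW E w),
        cellDensity η (η.map Prod.fst) c (c (x u.1)) j]
  exact Finset.prod_congr rfl fun w _ =>
    lintegral_prod_cellDensity_eq_starDensity hc (hB w) _

end BoxFormulas

section Approximation

variable {U W' : Type*} [Fintype U] [Fintype W'] [DecidableEq U] [DecidableEq W']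
  {η : Measure (J × J)} {π : Measure J} {P : Kernel J J} {E : Finset (U × W')}
  {ψ : ∀ w : W', Kernel (↥(nbrW E w) → J) J}

lemma filter_mem_nbrW (E : Finset (U × W')) (u : U) :
    (Finset.univ.filter fun w => u ∈ nbrW E w) = nbrU E u := by
  ext w
  simp [nbrW, nbrU]

lemma IsStarDisint.lintegral_univ [IsProbabilityMeasure π] [IsMarkovKernel P] {ι : Type*}
    [Fintype ι] {ψ : Kernel (ι → J) J} (hψ : IsStarDisint π P ψ) :
    ∫⁻ x, ψ x Set.univ ∂(Measure.pi fun _ : ι => π) = 1 := by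
  simpa using hψ.2 Set.univ Set.univ MeasurableSet.univ MeasurableSet.univ

lemma isFiniteMeasure_homMeasure [IsProbabilityMeasure π] [IsMarkovKernel P] {p : ℕ} (hp : 1 ≤ p)
    (hψ : ∀ w, IsStarDisint π P (ψ w)) (hdeg : ∀ u, (nbrU E u).card ≤ p)
    (hpow : ∀ w, ∫⁻ x, ψ w x Set.univ ^ p ∂(Measure.pi fun _ => π) < ⊤) :
    IsFiniteMeasure (homMeasure π E ψ) := by
  have hr : ∀ w, MeasurePreserving (fun (x : U → J) (u : ↥(nbrW E w)) => x u.1)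
      (Measure.pi fun _ => π) (Measure.pi fun _ => π) := fun w =>
    measurePreserving_pi_comp π Subtype.val_injective
  have hm : ∀ w, Measurable fun x => ψ w x Set.univ := fun w =>
    Kernel.measurable_coe (ψ w) MeasurableSet.univ
  refine ⟨?_⟩
  have hbox := homMeasure_box π E ψ (fun w => (hψ w).1) (A := fun _ => Set.univ)
    (B := fun _ => Set.univ) (fun _ => MeasurableSet.univ) fun _ => MeasurableSet.univ
  rw [Set.pi_univ, Set.pi_univ, Set.univ_prod_univ, Measure.restrict_univ] at hbox
  rw [hbox]
  refine (lintegral_prod_le_of_degree_le π Finset.univ p hp (nbrW E)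
    (fun w (x : U → J) => ψ w (fun u => x u.1) Set.univ) (fun w => (hm w).comp (hr w).measurable)
    (fun w u hu x y => by simp only [update_comp_val hu])
    fun u => (congrArg Finset.card (filter_mem_nbrW E u)).trans_le (hdeg u)).trans_lt ?_
  refine ENNReal.prod_lt_top fun w _ => ENNReal.rpow_lt_top_of_nonneg (by positivity) ?_
  have := (hr w).lintegral_comp ((hm w).pow_const p)
  rw [this]
  exact (hpow w).ne

variable {m : ℕ → ℕ} {c : ∀ i, J → Fin (m i)} {A : U → Set J} {B : W' → Set J}

lemma IsExhausting.tendsto_setLIntegral_prod_starDensity [IsFiniteMeasure η]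
    [IsProbabilityMeasure π] [IsMarkovKernel P] (hex : IsExhausting π c)
    (h : IsReversibleDisint η π P) (hψ : ∀ w, IsStarDisint π P (ψ w))
    (hB : ∀ w, MeasurableSet (B w)) (n : ℕ) (hdeg : ∀ u, (nbrU E u).card ≤ n + 2)
    (hpow : ∀ w, ∫⁻ x, ψ w x Set.univ ^ (n + 2) ∂(Measure.pi fun _ => π) < ⊤) :
    Tendsto (fun i => ∫⁻ x in Set.univ.pi A,
        ∏ w, starDensity η π (c i) ↥(nbrW E w) (B w) (fun u => x u.1)
          ∂(Measure.pi fun _ : U => π)) atTop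
      (nhds (∫⁻ x in Set.univ.pi A, ∏ w, ψ w (fun u => x u.1) (B w)
        ∂(Measure.pi fun _ : U => π))) := by
  have hr : ∀ w, MeasurePreserving (fun (x : U → J) (u : ↥(nbrW E w)) => x u.1)
      (Measure.pi fun _ => π) (Measure.pi fun _ => π) := fun w =>
    measurePreserving_pi_comp π Subtype.val_injective
  have hm : ∀ w, Measurable fun x => ψ w x (B w) := fun w => Kernel.measurable_coe (ψ w) (hB w)
  choose D hD hfs hsf hlim using fun w =>
    hex.exists_tendsto_starDensity h (hψ w) (hB w) n (hpow w)
  refine tendsto_lintegral_prod_of_degree_le π (n + 2) (by lia) (nbrW E)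
    (fun i w x => starDensity η π (c i) ↥(nbrW E w) (B w) fun u => x u.1)
    (fun w x => ψ w (fun u => x u.1) (B w)) (fun i w x => D w i fun u => x u.1)
    (fun i w => (measurable_starDensity (hex.measurable i) _ _).comp (hr w).measurable)
    (fun w => (hm w).comp (hr w).measurable) (fun i w => (hD w i).comp (hr w).measurable)
    (fun i w u hu x y => by simp only [update_comp_val hu])
    (fun w u hu x y => by simp only [update_comp_val hu])
    (fun i w u hu x y => by simp only [update_comp_val hu])
    (fun u => (congrArg Finset.card (filter_mem_nbrW E u)).trans_le (hdeg u)) (fun i w x => hfs w i _)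
    (fun i w x => hsf w i _) (fun w => ?_) (fun w => ?_) _
  · have := (hr w).lintegral_comp ((hm w).pow_const (n + 2))
    rw [this]
    exact (lintegral_mono fun x => pow_le_pow_left' (measure_mono (Set.subset_univ _)) _).trans_lt
      (hpow w)
  · refine (hlim w).congr fun i => ?_
    exact ((hr w).lintegral_comp ((hD w i).pow_const (n + 2))).symm

lemma IsExhausting.tendsto_setLIntegral_prod_starDensity_of_disjoint [IsProbabilityMeasure π]
    [IsMarkovKernel P] (hex : IsExhausting π c) (h : IsReversibleDisint η π P)
    (hψ : ∀ w, IsStarDisint π P (ψ w)) (hA : ∀ u, MeasurableSet (A u))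
    (hB : ∀ w, MeasurableSet (B w)) (hdeg : ∀ u, (nbrU E u).card ≤ 1) :
    Tendsto (fun i => ∫⁻ x in Set.univ.pi A,
        ∏ w, starDensity η π (c i) ↥(nbrW E w) (B w) (fun u => x u.1)
          ∂(Measure.pi fun _ : U => π)) atTop
      (nhds (∫⁻ x in Set.univ.pi A, ∏ w, ψ w (fun u => x u.1) (B w)
        ∂(Measure.pi fun _ : U => π))) := by
  have hN : ∀ v w, v ≠ w → Disjoint (nbrW E v) (nbrW E w) := by
    refine fun v w hvw => Finset.disjoint_left.2 fun u hv hw => hvw ?_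
    exact Finset.card_le_one.1 (hdeg u) v (by simpa [nbrW, nbrU] using hv) w
      (by simpa [nbrW, nbrU] using hw)
  obtain ⟨C, hC, hfactor⟩ := exists_setLIntegral_prod_eq π (nbrW E) hN A hA
  rw [hfactor (fun w z => ψ w z (B w)) fun w => Kernel.measurable_coe (ψ w) (hB w)]
  refine Tendsto.congr (fun i => (hfactor
    (fun w => starDensity η π (c i) ↥(nbrW E w) (B w))
    fun w => measurable_starDensity (hex.measurable i) _ _).symm) ?_
  refine ENNReal.Tendsto.const_mul (ENNReal.tendsto_finsetProd_of_ne_top _ (fun w _ =>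
    hex.tendsto_setLIntegral_pi_starDensity h (hψ w) (hB w) _ fun u => hA u.1) fun w _ => ?_)
    (Or.inr hC)
  refine ((setLIntegral_le_lintegral _ _).trans ((lintegral_mono fun x =>
    measure_mono (Set.subset_univ _)).trans (hψ w).lintegral_univ.le)).trans_lt
    ENNReal.one_lt_top |>.ne

end Approximation

/-- **Theorem (finiteness and partition approximability of `η^G`).**
Let `(J, η)` be a `(k,p)`-loose Markov space (stationary distribution `π = η ∘ fst⁻¹`,
disintegrating Markov kernel `P`) and `G = (U, W, E)` a bigraph with `deg(w) ≤ k` for all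
`w ∈ W` and `deg(u) ≤ p` for all `u ∈ U`.  Then the homomorphism measure `η^G` is a finite
measure, and it is partition approximable: for every exhausting partition sequence `(𝒫_i)`
(encoded by refining classifying maps `c i`) and every measurable box `C = ∏ B_v`,
`η_{𝒫_i}^G(C) → η^G(C)` as `i → ∞`. -/
theorem homMeasure_finite_and_partition_approximable
    {U W' : Type*} [Fintype U] [Fintype W'] [DecidableEq U] [DecidableEq W']
    [StandardBorelSpace J]
    (η : Measure (J × J)) [IsProbabilityMeasure η]
    (hsym : η.map Prod.swap = η)
    (P : Kernel J J) [IsMarkovKernel P]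
    (hP : ∀ A B : Set J, MeasurableSet A → MeasurableSet B →
      η (A ×ˢ B) = ∫⁻ x in A, P x B ∂(η.map Prod.fst))
    (k p : ℕ) (hloose : KPLoose (η.map Prod.fst) P k p)
    (E : Finset (U × W'))
    (hdegW : ∀ w : W', (nbrW E w).card ≤ k) (hdegU : ∀ u : U, (nbrU E u).card ≤ p)
    (ψ : ∀ w : W', Kernel (↥(nbrW E w) → J) J)
    (hψ : ∀ w : W', IsStarDisint (η.map Prod.fst) P (ψ w)) :
    IsFiniteMeasure (homMeasure (η.map Prod.fst) E ψ) ∧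
    ∀ (m : ℕ → ℕ) (c : ∀ i, J → Fin (m i)),
      (∀ i, Measurable (c i)) →
      (∀ i j, (η.map Prod.fst) ((c i) ⁻¹' {j}) ≠ 0) →
      (∀ i, ∃ g : Fin (m (i + 1)) → Fin (m i), c i = g ∘ c (i + 1)) →
      (∀ A : Set J, MeasurableSet A →
        ∃ B : Set J, MeasurableSet[⨆ i, MeasurableSpace.comap (c i) ⊤] B ∧
          (η.map Prod.fst) (symmDiff A B) = 0) →
      ∀ (A : U → Set J) (B : W' → Set J),
        (∀ u, MeasurableSet (A u)) → (∀ w, MeasurableSet (B w)) →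
        Tendsto (fun i => stepBoxVal η (c i) E A B) atTop
          (nhds (homMeasure (η.map Prod.fst) E ψ (Set.univ.pi A ×ˢ Set.univ.pi B))) := by
  have hπ : IsProbabilityMeasure (η.map Prod.fst) :=
    Measure.isProbabilityMeasure_map measurable_fst.aemeasurable
  have hrev : IsReversibleDisint η (η.map Prod.fst) P := by
    refine ⟨hP, fun A B hA hB => ?_⟩
    conv_lhs => rw [← hsym]
    rw [Measure.map_apply measurable_swap (hA.prod hB), Set.preimage_swap_prod]
  have hcard : ∀ w, Fintype.card ↥(nbrW E w) ≤ k := fun w =>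
    (Fintype.card_coe _).trans_le (hdegW w)
  refine ⟨?_, fun m c hc hne hg hex A B hA hB => ?_⟩
  · rcases p with _ | q
    · refine isFiniteMeasure_homMeasure le_rfl hψ (fun u => (hdegU u).trans zero_le_one) fun w => ?_
      simp only [pow_one, (hψ w).lintegral_univ, ENNReal.one_lt_top]
    · exact isFiniteMeasure_homMeasure (by lia) hψ hdegU fun w =>
        hloose.lintegral_pow_lt_top (hcard w) (hψ w)
  · have hexh : IsExhausting (η.map Prod.fst) c := ⟨hc, hne, hg, hex⟩
    simp only [stepBoxVal_eq η (hc _) E A hB,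
      homMeasure_box (η.map Prod.fst) E ψ (fun w => (hψ w).1) hA hB]
    rcases le_or_gt p 1 with hp | hp
    · exact hexh.tendsto_setLIntegral_prod_starDensity_of_disjoint hrev hψ hA hB
        fun u => (hdegU u).trans hp
    · obtain ⟨n, rfl⟩ := Nat.exists_eq_add_of_le' hp
      exact hexh.tendsto_setLIntegral_prod_starDensity hrev hψ hB n hdegU fun w =>
        hloose.lintegral_pow_lt_top (hcard w) (hψ w)
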